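/- Every metric graph of genus g ≥ 2 has at least one Weierstrass point. -/

import Mathlib

open scoped Classical

noncomputable section

/-! ## Combinatorial models of metric graphs and their topological realizations -/

/-- A combinatorial model of a metric graph: a finite multigraph with positive
edge lengths. -/
structure CombGraph : Type 1 where
  V : Type
  E : Type
  fintypeV : Fintype V
  fintypeE : Fintype E
  src : E → V
  tgt : E → V
  len : E → ℝ
  len_pos : ∀ e, 0 < len e

attribute [instance] CombGraph.fintypeV CombGraph.fintypeE

namespace CombGraph

variable (G : CombGraph)

instance : TopologicalSpace G.V := ⊥
instance : TopologicalSpace G.E := ⊥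

/-- The disjoint union of the vertices and of the edges seen as real intervals,
before gluing. -/
def Pre : Type := G.V ⊕ (G.E × ℝ)

instance : TopologicalSpace G.Pre := inferInstanceAs (TopologicalSpace (G.V ⊕ (G.E × ℝ)))

/-- The predicate selecting legitimate points: a point of an edge `e` must have its
coordinate in `[0, len e]`. -/
def Ok : G.Pre → Prop
  | Sum.inl _ => True
  | Sum.inr p => 0 ≤ p.2 ∧ p.2 ≤ G.len p.1

/-- Points of the model before gluing. -/
def PreR : Type := {p : G.Pre // G.Ok p}

instance : TopologicalSpace G.PreR := inferInstanceAs (TopologicalSpace {p : G.Pre // G.Ok p})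

/-- The gluing relation: the endpoints of each edge are glued to the corresponding
vertices. -/
inductive Glue : G.PreR → G.PreR → Prop
  | srcGlue (e : G.E) :
      Glue ⟨Sum.inl (G.src e), trivial⟩ ⟨Sum.inr (e, 0), ⟨le_refl 0, (G.len_pos e).le⟩⟩
  | tgtGlue (e : G.E) :
      Glue ⟨Sum.inl (G.tgt e), trivial⟩ ⟨Sum.inr (e, G.len e), ⟨(G.len_pos e).le, le_refl _⟩⟩

/-- The topological realization of the combinatorial model: the underlying
topological space of the associated metric graph. -/
def Space : Type := Quot G.Glue

instance : TopologicalSpace G.Space := inferInstanceAs (TopologicalSpace (Quot G.Glue))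

/-- The point of the realization corresponding to a vertex. -/
def vertexPt (v : G.V) : G.Space := Quot.mk _ ⟨Sum.inl v, trivial⟩

/-- Clamping of a real coordinate into `[0, len e]`. -/
def clamp (e : G.E) (t : ℝ) : ℝ := max 0 (min t (G.len e))

/-- The point of the realization lying on the edge `e` at coordinate `t`
(the coordinate is clamped into `[0, len e]`). -/
def edgePt (e : G.E) (t : ℝ) : G.Space :=
  Quot.mk _ ⟨Sum.inr (e, G.clamp e t),
    ⟨le_max_left 0 _, max_le (G.len_pos e).le (min_le_right _ _)⟩⟩

/-- The genus (first Betti number) of the (connected) metric graph. -/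
def genus : ℤ := (Fintype.card G.E : ℤ) - (Fintype.card G.V : ℤ) + 1

/-! ### Outgoing directions, valence -/

/-- `d = (e, b)` is an outgoing unit tangent direction at the point `x`:
if `b = true` it points in the direction of increasing coordinate on `e`, if
`b = false` in the direction of decreasing coordinate. -/
def IsDir (x : G.Space) (d : G.E × Bool) : Prop :=
  if d.2 then ∃ t, 0 ≤ t ∧ t < G.len d.1 ∧ x = G.edgePt d.1 t
  else ∃ t, 0 < t ∧ t ≤ G.len d.1 ∧ x = G.edgePt d.1 t

/-- The (finite) set of outgoing directions at a point. -/
def dirSet (x : G.Space) : Finset (G.E × Bool) :=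
  Finset.univ.filter fun d => G.IsDir x d

/-- The valence of a point of the realization: the number of outgoing
directions at that point. -/
def valence (x : G.Space) : ℕ := (G.dirSet x).card

/-- The coordinate on the edge `d.1` of a point `x` admitting `d` as an outgoing
direction. -/
def dirCoord (x : G.Space) (d : G.E × Bool) : ℝ :=
  if d.2 then
    (if h : ∃ t, 0 ≤ t ∧ t < G.len d.1 ∧ x = G.edgePt d.1 t then h.choose else 0)
  else
    (if h : ∃ t, 0 < t ∧ t ≤ G.len d.1 ∧ x = G.edgePt d.1 t then h.choose else 0)

/-- The point at distance `u` from `x` in the outgoing direction `d`. -/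
def dirPt (x : G.Space) (d : G.E × Bool) (u : ℝ) : G.Space :=
  G.edgePt d.1 (G.dirCoord x d + (if d.2 then u else -u))

end CombGraph

/-! ### Rational functions and divisors -/

/-- A function `g : [0, L] → ℝ` is piecewise integral affine if there is a finite
subdivision of `[0, L]` on whose pieces `g` is affine with integral slope. -/
def PWIntAffine (g : ℝ → ℝ) (L : ℝ) : Prop :=
  ∃ (n : ℕ) (t : ℕ → ℝ) (m : ℕ → ℤ) (b : ℕ → ℝ),
    t 0 = 0 ∧ t n = L ∧ (∀ i, i < n → t i < t (i + 1)) ∧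
    (∀ i, i < n → ∀ u, t i ≤ u → u ≤ t (i + 1) → g u = (m i : ℝ) * u + b i)

/-- A rational function on the metric graph realizing `G`: a continuous function
which is piecewise integral affine on every edge. -/
structure RatFn (G : CombGraph) where
  toFun : G.Space → ℝ
  continuous : Continuous toFun
  piecewise : ∀ e : G.E, PWIntAffine (fun t => toFun (G.edgePt e t)) (G.len e)

namespace CombGraph

variable (G : CombGraph)

/-- The right-hand slope of a rational function on the edge `e` at coordinate `t`. -/
def rightSlope (f : RatFn G) (e : G.E) (t : ℝ) : ℝ :=
  derivWithin (fun u => f.toFun (G.edgePt e u)) (Set.Ici t) t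

/-- The left-hand slope of a rational function on the edge `e` at coordinate `t`. -/
def leftSlope (f : RatFn G) (e : G.E) (t : ℝ) : ℝ :=
  derivWithin (fun u => f.toFun (G.edgePt e u)) (Set.Iic t) t

/-- The order of a rational function at a point: the sum of its outgoing slopes. -/
def ordAt (f : RatFn G) (x : G.Space) : ℝ :=
  if h : ∃ v : G.V, x = G.vertexPt v then
    ∑ e : G.E,
      ((if G.src e = h.choose then G.rightSlope f e 0 else 0)
        + (if G.tgt e = h.choose then -(G.leftSlope f e (G.len e)) else 0))
  else if h2 : ∃ p : G.E × ℝ, 0 < p.2 ∧ p.2 < G.len p.1 ∧ x = G.edgePt p.1 p.2 then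
    G.rightSlope f h2.choose.1 h2.choose.2 - G.leftSlope f h2.choose.1 h2.choose.2
  else 0

/-- The group of divisors of the metric graph: the free abelian group on the
points of the realization. -/
abbrev Div (G : CombGraph) : Type := G.Space →₀ ℤ

/-- The degree of a divisor. -/
def degDiv (D : Div G) : ℤ := D.sum fun _ n => n

/-- A divisor is effective if all of its coefficients are nonnegative. -/
def Effective (D : Div G) : Prop := ∀ x, 0 ≤ D x

/-- `D` is the principal divisor associated to the rational function `f`. -/
def IsPrincipal (D : Div G) (f : RatFn G) : Prop := ∀ x, (D x : ℝ) = G.ordAt f x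

/-- Two divisors are linearly equivalent if their difference is principal. -/
def LinEquiv (D D' : Div G) : Prop := ∃ f : RatFn G, G.IsPrincipal (D - D') f

/-- The Baker–Norine rank of a divisor: the largest integer `k` such that for every
effective divisor `E` of degree `k` the linear system `|D - E|` is nonempty.  (For
negative `k` the condition is vacuous, so the supremum is `-1` exactly when
`|D|` is empty.) -/
def Rk (D : Div G) : ℤ :=
  sSup {k : ℤ | ∀ E : Div G, G.Effective E → G.degDiv E = k →
    ∃ E' : Div G, G.Effective E' ∧ G.LinEquiv (D - E) E'}

/-- A point of a metric graph is a Weierstrass point if `rk(g·[x]) ≥ 1`. -/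
def IsWeierstrass (x : G.Space) : Prop :=
  1 ≤ G.Rk (G.genus • Finsupp.single x 1)

/-- The canonical divisor of a metric graph. -/
def canonical : Div G :=
  ∑ v : G.V, ((G.valence (G.vertexPt v) : ℤ) - 2) • Finsupp.single (G.vertexPt v) 1

end CombGraph

/-! ## Chip firing on finite multigraphs -/

namespace CombGraph

section ChipFiring

variable (G : CombGraph)

/-- The combinatorial Laplacian of an integer valued function on the vertices: the sum of the
outgoing slopes. -/
def lap (f : G.V → ℤ) (x : G.V) : ℤ :=
  ∑ e, ((if G.src e = x then 1 else 0) - (if G.tgt e = x then 1 else 0)) *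
    (f (G.tgt e) - f (G.src e))

/-- The canonical divisor of the underlying multigraph. -/
def can (x : G.V) : ℤ :=
  ∑ e, ((if G.src e = x then 1 else 0) + (if G.tgt e = x then 1 else 0)) - 2

/-- Combinatorial connectedness: a nonempty set of vertices saturated under adjacency
is everything. -/
def Linked : Prop :=
  ∀ A : Set G.V, A.Nonempty → (∀ e, G.src e ∈ A ↔ G.tgt e ∈ A) → A = Set.univ

/-- There are no loops. -/
def Loopless : Prop := ∀ e, G.src e ≠ G.tgt e

variable {G}

lemma lap_add (f h : G.V → ℤ) (x : G.V) :
    G.lap (fun v => f v + h v) x = G.lap f x + G.lap h x := by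
  simp only [lap, ← Finset.sum_add_distrib]
  exact Finset.sum_congr rfl fun e _ => by ring

lemma lap_mul (c : ℤ) (f : G.V → ℤ) (x : G.V) :
    G.lap (fun v => c * f v) x = c * G.lap f x := by
  simp only [lap, Finset.mul_sum]
  exact Finset.sum_congr rfl fun e _ => by ring

lemma lap_add_const (c : ℤ) (f : G.V → ℤ) (x : G.V) :
    G.lap (fun v => f v + c) x = G.lap f x := by
  simp [lap]

lemma sum_mul_lap (χ f : G.V → ℤ) :
    ∑ x, χ x * G.lap f x =
      -∑ e, (χ (G.tgt e) - χ (G.src e)) * (f (G.tgt e) - f (G.src e)) := by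
  simp only [lap, Finset.mul_sum]
  rw [Finset.sum_comm, ← Finset.sum_neg_distrib]
  refine Finset.sum_congr rfl fun e _ => ?_
  have : ∀ x, χ x * (((if G.src e = x then 1 else 0) - (if G.tgt e = x then 1 else 0)) *
      (f (G.tgt e) - f (G.src e))) = (if G.src e = x then χ x else 0) *
      (f (G.tgt e) - f (G.src e)) - (if G.tgt e = x then χ x else 0) *
      (f (G.tgt e) - f (G.src e)) := by
    intro x; split_ifs <;> ring
  simp only [this, Finset.sum_sub_distrib, ← Finset.sum_mul, Finset.sum_ite_eq,
    Finset.mem_univ, if_true]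
  ring

lemma sum_lap (f : G.V → ℤ) : ∑ x, G.lap f x = 0 := by
  simpa using sum_mul_lap (fun _ => 1) f

lemma sum_can : ∑ x, G.can x = 2 * ((Fintype.card G.E : ℤ) - Fintype.card G.V) := by
  simp only [can, Finset.sum_sub_distrib]
  rw [Finset.sum_comm]
  simp [Finset.sum_add_distrib]
  ring

lemma lap_le_of_touch {f m : G.V → ℤ} {x : G.V} (h : ∀ v, f v ≤ m v) (hx : f x = m x) :
    G.lap f x ≤ G.lap m x := by
  refine Finset.sum_le_sum fun e _ => ?_
  have h1 := h (G.src e)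
  have h2 := h (G.tgt e)
  split_ifs with a b b
  · simp
  · subst a; linarith
  · subst b; linarith
  · simp

/-- The linear system of a divisor is stable under pointwise maxima. -/
lemma lap_max_nonneg {D f h : G.V → ℤ} (hf : ∀ x, 0 ≤ D x + G.lap f x)
    (hh : ∀ x, 0 ≤ D x + G.lap h x) (x : G.V) : 0 ≤ D x + G.lap (fun v => max (f v) (h v)) x := by
  rcases le_total (f x) (h x) with hx | hx
  · have := lap_le_of_touch (f := h) (m := fun v => max (f v) (h v)) (x := x)
      (fun v => le_max_right _ _) (by simp [hx])
    linarith [hh x]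
  · have := lap_le_of_touch (f := f) (m := fun v => max (f v) (h v)) (x := x)
      (fun v => le_max_left _ _) (by simp [hx])
    linarith [hf x]

lemma abs_slope_le_of_superlevel {D f : G.V → ℤ} {c : ℤ}
    (h : ∀ x, c ≤ f x → 0 ≤ D x + G.lap f x) (e : G.E)
    (hc : max (f (G.tgt e)) (f (G.src e)) = c) :
    |f (G.tgt e) - f (G.src e)| ≤ ∑ x, |D x| := by
  by_cases heq : f (G.tgt e) = f (G.src e)
  · simp only [heq, sub_self, abs_zero]; positivity
  have key := sum_mul_lap (fun x => if c ≤ f x then 1 else 0) f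
  have h1 : 0 ≤ ∑ x, (if c ≤ f x then (1 : ℤ) else 0) * (D x + G.lap f x) :=
    Finset.sum_nonneg fun x _ => by
      split_ifs with hx
      · simpa using h x hx
      · simp
  have h2 : ∑ x, (if c ≤ f x then (1 : ℤ) else 0) * D x ≤ ∑ x, |D x| :=
    Finset.sum_le_sum fun x _ => by
      split_ifs with hx
      · simpa using le_abs_self (D x)
      · simp
  have hterm : ∀ e', 0 ≤ ((if c ≤ f (G.tgt e') then (1 : ℤ) else 0) -
      (if c ≤ f (G.src e') then 1 else 0)) * (f (G.tgt e') - f (G.src e')) := by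
    intro e'
    split_ifs <;> first | simp; done | (simp; omega)
  have h3 := Finset.single_le_sum (fun e' _ => hterm e') (Finset.mem_univ e)
  have h4 : ((if c ≤ f (G.tgt e) then (1 : ℤ) else 0) -
      (if c ≤ f (G.src e) then 1 else 0)) * (f (G.tgt e) - f (G.src e)) =
      |f (G.tgt e) - f (G.src e)| := by
    rcases lt_or_gt_of_ne heq with hlt | hlt
    · rw [max_eq_right hlt.le] at hc
      rw [abs_of_neg (by linarith), if_neg (by linarith), if_pos hc.ge]; ring
    · rw [max_eq_left hlt.le] at hc
      rw [abs_of_pos (by linarith), if_pos hc.ge, if_neg (by linarith)]; ring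
  simp only [mul_add, Finset.sum_add_distrib] at h1
  linarith

/-- Functions in a linear system have uniformly bounded slopes. -/
lemma abs_slope_le {D f : G.V → ℤ} (h : ∀ x, 0 ≤ D x + G.lap f x) (e : G.E) :
    |f (G.tgt e) - f (G.src e)| ≤ ∑ x, |D x| :=
  abs_slope_le_of_superlevel (fun x _ => h x) e rfl

lemma lap_indicator_nonneg {A : Finset G.V} {x : G.V} (hx : x ∉ A) :
    0 ≤ G.lap (fun v => if v ∈ A then 1 else 0) x := by
  refine Finset.sum_nonneg fun e _ => ?_
  by_cases a : G.src e = x <;> by_cases b : G.tgt e = x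
  · simp [a, b]
  · simp only [a, b, hx]; split_ifs <;> simp
  · simp only [a, b, hx]; split_ifs <;> simp
  · simp [a, b]

lemma exists_lap_pos_off (hG : G.Linked) (q : G.V) :
    ∃ f : G.V → ℤ, ∀ x, x ≠ q → 1 ≤ G.lap f x := by
  set W : ℤ := ∑ x, ∑ A : Finset G.V, |G.lap (fun v => if v ∈ A then 1 else 0) x| with hW
  have hWle : ∀ (A : Finset G.V) x, -W ≤ G.lap (fun v => if v ∈ A then 1 else 0) x := by
    intro A x
    have h1 := Finset.single_le_sum (f := fun A : Finset G.V =>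
      |G.lap (fun v => if v ∈ A then 1 else 0) x|) (fun _ _ => abs_nonneg _) (Finset.mem_univ A)
    have h2 := Finset.single_le_sum (f := fun x => ∑ A : Finset G.V,
      |G.lap (fun v => if v ∈ A then 1 else 0) x|)
      (fun _ _ => Finset.sum_nonneg fun _ _ => abs_nonneg _) (Finset.mem_univ x)
    have h3 := neg_abs_le (G.lap (fun v => if v ∈ A then 1 else 0) x)
    linarith
  have hW0 : 0 ≤ W := Finset.sum_nonneg fun _ _ => Finset.sum_nonneg fun _ _ => abs_nonneg _
  suffices H : ∀ n (A : Finset G.V), q ∈ A → Aᶜ.card = n →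
      (∃ f : G.V → ℤ, (∀ x ∈ A, x ≠ q → 1 ≤ G.lap f x) ∧ ∀ x ∉ A, 0 ≤ G.lap f x) →
      ∃ f : G.V → ℤ, ∀ x, x ≠ q → 1 ≤ G.lap f x by
    refine H _ {q} (by simp) rfl ⟨fun _ => 0, ?_, ?_⟩
    · intro x hx hne; simp at hx; exact absurd hx hne
    · intro x _; simp [lap]
  intro n
  induction n with
  | zero =>
    rintro A - hA ⟨f, hf, -⟩
    have : A = Finset.univ := by simpa using hA
    exact ⟨f, fun x hx => hf x (by simp [this]) hx⟩
  | succ n ih =>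
    rintro A hq hA ⟨f, hf, hf'⟩
    have hne : (A : Set G.V) ≠ Set.univ := by
      intro h
      have : A = Finset.univ := by exact_mod_cast h
      simp [this] at hA
    have : ¬ ∀ e, G.src e ∈ (A : Set G.V) ↔ G.tgt e ∈ (A : Set G.V) :=
      fun h => hne (hG A ⟨q, hq⟩ h)
    push Not at this
    obtain ⟨e, he⟩ := this
    obtain ⟨v, hv, hv1⟩ : ∃ v, v ∉ A ∧ 1 ≤ G.lap (fun v => if v ∈ A then 1 else 0) v := by
      have key : ∀ v, v ∉ A → (G.src e = v ∧ G.tgt e ∈ A ∨ G.tgt e = v ∧ G.src e ∈ A) →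
          1 ≤ G.lap (fun v => if v ∈ A then 1 else 0) v := by
        intro v hv hcase
        have h0 : ∀ e', 0 ≤ (((if G.src e' = v then 1 else 0) -
            (if G.tgt e' = v then 1 else 0)) * ((if G.tgt e' ∈ A then (1 : ℤ) else 0) -
            (if G.src e' ∈ A then 1 else 0)) : ℤ) := by
          intro e'
          by_cases a : G.src e' = v <;> by_cases b : G.tgt e' = v
          · simp [a, b]
          · simp only [a, b, hv]; split_ifs <;> simp
          · simp only [a, b, hv]; split_ifs <;> simp
          · simp [a, b]
        refine le_trans ?_ (Finset.single_le_sum (fun e' _ => h0 e') (Finset.mem_univ e))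
        rcases hcase with ⟨h1, h2⟩ | ⟨h1, h2⟩
        · have : G.tgt e ≠ v := fun h => hv (h ▸ h2)
          simp [h1, h2, this, hv]
        · have : G.src e ≠ v := fun h => hv (h ▸ h2)
          simp [h1, h2, this, hv]
      rcases he with ⟨h1, h2⟩ | ⟨h1, h2⟩
      · exact ⟨G.tgt e, h2, key _ h2 (Or.inr ⟨rfl, h1⟩)⟩
      · exact ⟨G.src e, h1, key _ h1 (Or.inl ⟨rfl, h2⟩)⟩
    refine ih (insert v A) (by simp [hq]) ?_
      ⟨fun x => (W + 1) * f x + if x ∈ A then 1 else 0, ?_, ?_⟩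
    · rw [Finset.card_compl] at hA ⊢
      rw [Finset.card_insert_of_notMem hv]; omega
    · intro x hx hxq
      rw [lap_add, lap_mul]
      rcases Finset.mem_insert.1 hx with rfl | hx
      · have := hf' x hv
        nlinarith
      · have h1 := hf x hx hxq
        have := hWle A x
        nlinarith
    · intro x hx
      rw [Finset.mem_insert, not_or] at hx
      rw [lap_add, lap_mul]
      have := hf' x hx.2
      have := lap_indicator_nonneg hx.2
      nlinarith

/-- Existence of `q`-reduced divisors. -/
lemma exists_reduced (hG : G.Linked) (D : G.V → ℤ) (q : G.V) :
    ∃ f : G.V → ℤ, (∀ x, x ≠ q → 0 ≤ D x + G.lap f x) ∧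
      ∀ A : Finset G.V, A.Nonempty → q ∉ A →
        ∃ v ∈ A, D v + G.lap f v + G.lap (fun u => if u ∈ A then 1 else 0) v < 0 := by
  set S : Set (G.V → ℤ) := {f | f q = 0 ∧ ∀ x, x ≠ q → 0 ≤ D x + G.lap f x} with hS
  have hne : ∃ f, f ∈ S := by
    obtain ⟨f, hf⟩ := exists_lap_pos_off hG q
    set B := ∑ x, |D x|
    have hB : ∀ x, |D x| ≤ B := fun x =>
      Finset.single_le_sum (fun y _ => abs_nonneg (D y)) (Finset.mem_univ x)
    refine ⟨fun x => B * f x + -(B * f q), by ring, fun x hx => ?_⟩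
    rw [lap_add_const, lap_mul]
    have := hB x
    have := hf x hx
    have := neg_abs_le (D x)
    have := abs_nonneg (D x)
    nlinarith
  have hbdd : ∀ v, ∃ c : ℤ, 0 ≤ c ∧ ∀ f ∈ S, f v ≤ c := by
    have := hG {v | ∃ c : ℤ, 0 ≤ c ∧ ∀ f ∈ S, f v ≤ c} ⟨q, 0, le_rfl, fun f hf => hf.1.le⟩ ?_
    · intro v
      have hv : v ∈ (Set.univ : Set G.V) := trivial
      rw [← this] at hv
      exact hv
    · intro e
      have step : ∀ f ∈ S, 0 < max (f (G.tgt e)) (f (G.src e)) →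
          |f (G.tgt e) - f (G.src e)| ≤ ∑ x, |D x| := by
        intro f hf hpos
        refine abs_slope_le_of_superlevel (fun x hx => hf.2 x ?_) e rfl
        rintro rfl
        rw [hf.1] at hx
        exact absurd hpos (not_lt.2 hx)
      have hB : 0 ≤ ∑ x, |D x| := Finset.sum_nonneg fun x _ => abs_nonneg (D x)
      constructor
      · rintro ⟨c, hc, h⟩
        refine ⟨c + ∑ x, |D x|, by linarith, fun f hf => ?_⟩
        by_contra! hlt
        have := abs_le.1 (step f hf (lt_max_of_lt_left (by linarith)))
        linarith [h f hf]
      · rintro ⟨c, hc, h⟩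
        refine ⟨c + ∑ x, |D x|, by linarith, fun f hf => ?_⟩
        by_contra! hlt
        have := abs_le.1 (step f hf (lt_max_of_lt_right (by linarith)))
        linarith [h f hf]
  choose c hc0 hc using hbdd
  obtain ⟨M, ⟨f, hfS, hfM⟩, hM⟩ := Int.exists_greatest_of_bdd
    (P := fun z => ∃ f ∈ S, ∑ x, f x = z)
    ⟨∑ x, c x, by rintro z ⟨f, hf, rfl⟩; exact Finset.sum_le_sum fun x _ => hc x f hf⟩
    (by obtain ⟨f, hf⟩ := hne; exact ⟨_, f, hf, rfl⟩)
  refine ⟨f, hfS.2, fun A hA hq => ?_⟩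
  by_contra! hcon
  have := hM _ ⟨fun x => f x + if x ∈ A then 1 else 0, ⟨?_, fun x hx => ?_⟩, rfl⟩
  · rw [Finset.sum_add_distrib, hfM] at this
    simp at this
    exact hA.ne_empty this
  · simp [hfS.1, hq]
  · rw [lap_add]
    by_cases hxA : x ∈ A
    · linarith [hcon x hxA]
    · linarith [hfS.2 x hx, lap_indicator_nonneg hxA]

/-- Dhar's burning algorithm: a reduced divisor with no chip at `q` is dominated by the
divisor of an acyclic orientation, here encoded by an injective ranking of the vertices. -/
lemma exists_ranking {D : G.V → ℤ} {q : G.V} (hq : D q < 0)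
    (hred : ∀ A : Finset G.V, A.Nonempty → q ∉ A →
        ∃ v ∈ A, D v + G.lap (fun u => if u ∈ A then 1 else 0) v < 0) :
    ∃ r : G.V → ℕ, Function.Injective r ∧ ∀ v, D v + 1 ≤
      ∑ e, if (G.src e = v ∧ r (G.tgt e) < r v) ∨ (G.tgt e = v ∧ r (G.src e) < r v)
        then (1 : ℤ) else 0 := by
  suffices H : ∀ n (B : Finset G.V), q ∈ B → Bᶜ.card = n →
      (∃ r : G.V → ℕ, Set.InjOn r B ∧ (∀ v ∈ B, r v < B.card) ∧ ∀ v ∈ B, D v + 1 ≤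
        ∑ e, if (G.src e = v ∧ G.tgt e ∈ B ∧ r (G.tgt e) < r v) ∨
          (G.tgt e = v ∧ G.src e ∈ B ∧ r (G.src e) < r v) then (1 : ℤ) else 0) →
      ∃ r : G.V → ℕ, Function.Injective r ∧ ∀ v, D v + 1 ≤
      ∑ e, if (G.src e = v ∧ r (G.tgt e) < r v) ∨ (G.tgt e = v ∧ r (G.src e) < r v)
        then (1 : ℤ) else 0 by
    refine H _ {q} (by simp) rfl ⟨fun _ => 0, by simp, by simp, ?_⟩
    intro v hv
    obtain rfl : v = q := by simpa using hv
    refine le_trans (by omega : D v + 1 ≤ 0) (Finset.sum_nonneg fun e _ => ?_)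
    split_ifs <;> simp
  intro n
  induction n with
  | zero =>
    rintro B - hB ⟨r, hr, -, h⟩
    obtain rfl : B = Finset.univ := by simpa using hB
    refine ⟨r, by simpa using hr, fun v => ?_⟩
    simpa using h v (Finset.mem_univ v)
  | succ n ih =>
    rintro B hqB hB ⟨r, hr, hlt, h⟩
    obtain ⟨v, hvB, hv⟩ := hred Bᶜ (by rw [← Finset.card_pos]; omega) (by simpa using hqB)
    rw [Finset.mem_compl] at hvB
    have hne : ∀ u ∈ B, u ≠ v := fun u hu huv => hvB (huv ▸ hu)
    refine ih (insert v B) (by simp [hqB]) ?_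
      ⟨fun u => if u = v then B.card else r u, ?_, ?_, ?_⟩
    · rw [Finset.card_compl] at hB ⊢
      rw [Finset.card_insert_of_notMem hvB]; omega
    · intro a ha b hb hab
      simp only [Finset.coe_insert, Set.mem_insert_iff, Finset.mem_coe] at ha hb
      simp only at hab
      rcases ha with rfl | ha <;> rcases hb with rfl | hb
      · rfl
      · rw [if_pos rfl, if_neg (hne b hb)] at hab
        exact absurd hab (hlt b hb).ne'
      · rw [if_pos rfl, if_neg (hne a ha)] at hab
        exact absurd hab (hlt a ha).ne
      · rw [if_neg (hne a ha), if_neg (hne b hb)] at hab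
        exact hr ha hb hab
    · intro u hu
      rw [Finset.card_insert_of_notMem hvB]
      rcases Finset.mem_insert.1 hu with rfl | hu
      · simp
      · simp only [if_neg (hne u hu)]
        have := hlt u hu
        omega
    · intro u hu
      rcases Finset.mem_insert.1 hu with rfl | hu
      · refine (show D u + 1 ≤ -G.lap (fun w => if w ∈ Bᶜ then 1 else 0) u by omega).trans ?_
        rw [lap, ← Finset.sum_neg_distrib]
        refine Finset.sum_le_sum fun e _ => ?_
        by_cases a : G.src e = u <;> by_cases b : G.tgt e = u
        · simp [a, b]
        · by_cases hb : G.tgt e ∈ B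
          · simp [a, b, hb, hvB, hlt]
          · simp [a, b, hb, hvB]
        · by_cases hb : G.src e ∈ B
          · simp [a, b, hb, hvB, hlt]
          · simp [a, b, hb, hvB]
        · simp [a, b]
      · refine (h u hu).trans (Finset.sum_le_sum fun e _ => ?_)
        by_cases hc : (G.src e = u ∧ G.tgt e ∈ B ∧ r (G.tgt e) < r u) ∨
          (G.tgt e = u ∧ G.src e ∈ B ∧ r (G.src e) < r u)
        · rw [if_pos hc, if_pos]
          refine hc.imp ?_ ?_
          · rintro ⟨h1, h2, h3⟩
            refine ⟨h1, Finset.mem_insert_of_mem h2, ?_⟩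
            simpa [hne _ h2, hne _ hu] using h3
          · rintro ⟨h1, h2, h3⟩
            refine ⟨h1, Finset.mem_insert_of_mem h2, ?_⟩
            simpa [hne _ h2, hne _ hu] using h3
        · rw [if_neg hc]; split_ifs <;> simp

/-- The symmetry of the theta divisor: in degree `g - 1`, if `K - D` is equivalent to an effective
divisor, then so is `D`. -/
theorem exists_effective_of_residual (hG : G.Linked) (hl : G.Loopless) (hV : Nonempty G.V)
    {D : G.V → ℤ} (hdeg : ∑ x, D x = (Fintype.card G.E : ℤ) - Fintype.card G.V)
    (hres : ∃ f : G.V → ℤ, ∀ x, 0 ≤ G.can x - D x + G.lap f x) :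
    ∃ f : G.V → ℤ, ∀ x, 0 ≤ D x + G.lap f x := by
  obtain ⟨q⟩ := hV
  obtain ⟨f₀, hf₀, hred⟩ := exists_reduced hG D q
  by_cases hq : 0 ≤ D q + G.lap f₀ q
  · exact ⟨f₀, fun x => if hx : x = q then hx ▸ hq else hf₀ x hx⟩
  exfalso
  obtain ⟨r, hr, hle⟩ := exists_ranking (D := fun x => D x + G.lap f₀ x) (not_le.1 hq) hred
  have hrne : ∀ e, r (G.src e) ≠ r (G.tgt e) := fun e h => hl e (hr h)
  have hsum : ∑ v, ((∑ e, if (G.src e = v ∧ r (G.tgt e) < r v) ∨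
      (G.tgt e = v ∧ r (G.src e) < r v) then (1 : ℤ) else 0) - (D v + G.lap f₀ v + 1)) = 0 := by
    rw [Finset.sum_sub_distrib, Finset.sum_comm]
    have : ∀ e, ∑ v, (if (G.src e = v ∧ r (G.tgt e) < r v) ∨
      (G.tgt e = v ∧ r (G.src e) < r v) then (1 : ℤ) else 0) = 1 := by
      intro e
      rcases lt_or_gt_of_ne (hrne e) with h | h
      · rw [Finset.sum_eq_single (G.tgt e)]
        · simp [h]
        · intro b _ hb
          rw [if_neg]
          rintro (⟨rfl, h'⟩ | ⟨rfl, h'⟩)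
          · omega
          · exact hb rfl
        · simp
      · rw [Finset.sum_eq_single (G.src e)]
        · simp [h]
        · intro b _ hb
          rw [if_neg]
          rintro (⟨rfl, h'⟩ | ⟨rfl, h'⟩)
          · exact hb rfl
          · omega
        · simp
    simp only [this, Finset.sum_add_distrib, sum_lap, hdeg]
    simp
  rw [Finset.sum_eq_zero_iff_of_nonneg (fun v _ => sub_nonneg.2 (hle v))] at hsum
  obtain ⟨f₁, hf₁⟩ := hres
  set f : G.V → ℤ := fun x => f₁ x + f₀ x with hf
  have hK : ∀ x, 0 ≤ G.can x - (D x + G.lap f₀ x) + G.lap f x := by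
    intro x; rw [hf, lap_add]; linarith [hf₁ x]
  obtain ⟨w, -, hw⟩ := Finset.exists_max_image Finset.univ f ⟨q, Finset.mem_univ q⟩
  obtain ⟨v, hvA, hv⟩ := Finset.exists_max_image (Finset.univ.filter fun v => f v = f w) r
    ⟨w, by simp⟩
  have hvw : f v = f w := by simpa using hvA
  have hmax : ∀ u, f u ≤ f v := fun u => hvw ▸ hw u (Finset.mem_univ u)
  have hlt : ∀ u, r v < r u → f u + 1 ≤ f v := by
    intro u hu
    refine lt_of_le_of_ne (hmax u) fun h => ?_
    exact absurd (hv u (by simp [h, hvw])) (not_le.2 hu)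
  have hKv := hK v
  have hDv := hsum v (Finset.mem_univ v)
  have : G.can v + 2 - (∑ e, if (G.src e = v ∧ r (G.tgt e) < r v) ∨
      (G.tgt e = v ∧ r (G.src e) < r v) then (1 : ℤ) else 0) + G.lap f v ≤ 0 := by
    simp only [can, lap, sub_add_cancel]
    rw [← Finset.sum_sub_distrib, ← Finset.sum_add_distrib]
    refine Finset.sum_nonpos fun e _ => ?_
    have h1 := hmax (G.src e)
    have h2 := hmax (G.tgt e)
    have h3 := hlt (G.src e)
    have h4 := hlt (G.tgt e)
    have h5 := hrne e
    by_cases a : G.src e = v <;> by_cases b : G.tgt e = v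
    · exact absurd (a.trans b.symm) (hl e)
    · rw [a] at h5
      by_cases c : r (G.tgt e) < r v
      · simp [a, b, c]; linarith
      · simp [a, b, c]; linarith [h4 (by omega)]
    · rw [b] at h5
      by_cases c : r (G.src e) < r v
      · simp [a, b, c]; linarith
      · simp [a, b, c]; linarith [h3 (by omega)]
    · simp [a, b]
  linarith

end ChipFiring

end CombGraph

/-! ## Subdivisions -/

namespace CombGraph

section Subdivision

variable (G : CombGraph) (m : G.E → ℕ)

/-- The `i`-th point of the chain subdividing the edge `e` by `m e` inner points. -/
def chainPt (e : G.E) (i : ℕ) : G.V ⊕ (Σ e, Fin (m e)) :=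
  if i = 0 then Sum.inl (G.src e)
  else if h : i - 1 < m e then Sum.inr ⟨e, ⟨i - 1, h⟩⟩ else Sum.inl (G.tgt e)

/-- The subdivision of `G` putting `m e` inner points on the edge `e`, with unit lengths. -/
abbrev subdiv : CombGraph where
  V := G.V ⊕ (Σ e, Fin (m e))
  E := Σ e, Fin (m e + 1)
  fintypeV := inferInstance
  fintypeE := inferInstance
  src a := G.chainPt m a.1 a.2
  tgt a := G.chainPt m a.1 (a.2 + 1)
  len _ := 1
  len_pos _ := one_pos

variable {G m}

@[simp] lemma chainPt_zero (e : G.E) : G.chainPt m e 0 = Sum.inl (G.src e) := by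
  simp [chainPt]

lemma chainPt_inner {e : G.E} {i : ℕ} (h : i < m e) :
    G.chainPt m e (i + 1) = Sum.inr ⟨e, ⟨i, h⟩⟩ := by
  simp [chainPt, h]

lemma chainPt_last {e : G.E} {i : ℕ} (h : m e < i) : G.chainPt m e i = Sum.inl (G.tgt e) := by
  rw [chainPt, if_neg (by omega), dif_neg (by omega)]

lemma chainPt_eq_inl {e : G.E} {i : ℕ} {v : G.V} :
    G.chainPt m e i = Sum.inl v ↔ (i = 0 ∧ G.src e = v) ∨ (m e < i ∧ G.tgt e = v) := by
  rcases i with _ | i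
  · simp
  · by_cases h : i < m e
    · simp [chainPt_inner h]; omega
    · rw [chainPt_last (by omega)]; simp; omega

lemma chainPt_eq_inr {e e₀ : G.E} {i k : ℕ} (hk : k < m e₀) :
    G.chainPt m e i = Sum.inr ⟨e₀, ⟨k, hk⟩⟩ ↔ e = e₀ ∧ i = k + 1 := by
  rcases i with _ | i
  · simp
  · by_cases h : i < m e
    · rw [chainPt_inner h]
      constructor
      · intro h'
        have h' := Sum.inr.inj h'
        obtain ⟨rfl, h2⟩ := Sigma.mk.inj h'
        simp at h2
        simp [h2]
      · rintro ⟨rfl, h2⟩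
        simp at h2
        subst h2
        rfl
    · rw [chainPt_last (by omega)]
      simp
      rintro rfl
      omega

lemma exists_eq_chainPt (hinc : ∀ v, ∃ e, G.src e = v ∨ G.tgt e = v) (x : (G.subdiv m).V) :
    ∃ e i, i ≤ m e + 1 ∧ x = G.chainPt m e i := by
  rcases x with v | ⟨e, i, hi⟩
  · obtain ⟨e, he | he⟩ := hinc v
    · exact ⟨e, 0, by omega, by simp [he]⟩
    · exact ⟨e, m e + 1, le_rfl, by rw [chainPt_last (by omega), he]⟩
  · exact ⟨e, i + 1, by omega, (chainPt_inner hi).symm⟩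

lemma sum_subdiv_E (ψ : G.E → ℕ → ℤ) :
    ∑ a : (G.subdiv m).E, ψ a.1 a.2 = ∑ e, ∑ i ∈ Finset.range (m e + 1), ψ e i := by
  refine (Fintype.sum_sigma (fun a : Σ e, Fin (m e + 1) => ψ a.1 a.2)).trans ?_
  exact Finset.sum_congr rfl fun e _ => Fin.sum_univ_eq_sum_range (ψ e) (m e + 1)

lemma sum_subdiv_V (ψ : (G.subdiv m).V → ℤ) :
    ∑ x : (G.subdiv m).V, ψ x = ∑ v : G.V, ψ (Sum.inl v) + ∑ a, ψ (Sum.inr a) :=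
  Fintype.sum_sum_type (fun x : G.V ⊕ (Σ e, Fin (m e)) => ψ x)

lemma card_subdiv : (Fintype.card (G.subdiv m).E : ℤ) - Fintype.card (G.subdiv m).V =
    (Fintype.card G.E : ℤ) - Fintype.card G.V := by
  have h1 : Fintype.card (G.subdiv m).E = ∑ e, (m e + 1) := by
    refine (Fintype.card_sigma (α := fun e => Fin (m e + 1))).trans (by simp)
  have h2 : Fintype.card (G.subdiv m).V = Fintype.card G.V + ∑ e, m e := by
    refine (Fintype.card_sum (α := G.V) (β := Σ e, Fin (m e))).trans ?_
    rw [Fintype.card_sigma]; simp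
  rw [h1, h2, Finset.sum_add_distrib]
  simp
  ring

lemma sum_chain_src_inl (e : G.E) (v : G.V) (φ : ℕ → ℤ) :
    ∑ i ∈ Finset.range (m e + 1), (if G.chainPt m e i = Sum.inl v then φ i else 0) =
      if G.src e = v then φ 0 else 0 := by
  rw [Finset.sum_range_succ', Finset.sum_eq_zero, zero_add]
  · simp
  · intro i hi
    rw [Finset.mem_range] at hi
    rw [chainPt_inner hi]; simp

lemma sum_chain_tgt_inl (e : G.E) (v : G.V) (φ : ℕ → ℤ) :
    ∑ i ∈ Finset.range (m e + 1), (if G.chainPt m e (i + 1) = Sum.inl v then φ i else 0) =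
      if G.tgt e = v then φ (m e) else 0 := by
  rw [Finset.sum_range_succ, Finset.sum_eq_zero, zero_add]
  · rw [chainPt_last (by omega)]; simp
  · intro i hi
    rw [Finset.mem_range] at hi
    rw [chainPt_inner hi]; simp

lemma sum_chain_src_inr {e₀ : G.E} {k : ℕ} (hk : k < m e₀) (φ : G.E → ℕ → ℤ) :
    ∑ e, ∑ i ∈ Finset.range (m e + 1),
      (if G.chainPt m e i = Sum.inr ⟨e₀, ⟨k, hk⟩⟩ then φ e i else 0) = φ e₀ (k + 1) := by
  simp only [chainPt_eq_inr]
  rw [Finset.sum_eq_single e₀]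
  · simp; omega
  · intro b _ hb; simp [hb]
  · simp

lemma sum_chain_tgt_inr {e₀ : G.E} {k : ℕ} (hk : k < m e₀) (φ : G.E → ℕ → ℤ) :
    ∑ e, ∑ i ∈ Finset.range (m e + 1),
      (if G.chainPt m e (i + 1) = Sum.inr ⟨e₀, ⟨k, hk⟩⟩ then φ e i else 0) = φ e₀ k := by
  simp only [chainPt_eq_inr]
  rw [Finset.sum_eq_single e₀]
  · simp; omega
  · intro b _ hb; simp [hb]
  · simp

lemma lap_subdiv (f : (G.subdiv m).V → ℤ) (x : (G.subdiv m).V) :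
    (G.subdiv m).lap f x =
      ∑ e, ∑ i ∈ Finset.range (m e + 1), (if G.chainPt m e i = x then
        f (G.chainPt m e (i + 1)) - f (G.chainPt m e i) else 0) -
      ∑ e, ∑ i ∈ Finset.range (m e + 1), (if G.chainPt m e (i + 1) = x then
        f (G.chainPt m e (i + 1)) - f (G.chainPt m e i) else 0) := by
  rw [← sum_subdiv_E (fun e i => if G.chainPt m e i = x then
        f (G.chainPt m e (i + 1)) - f (G.chainPt m e i) else 0),
    ← sum_subdiv_E (fun e i => if G.chainPt m e (i + 1) = x then
        f (G.chainPt m e (i + 1)) - f (G.chainPt m e i) else 0), lap, ← Finset.sum_sub_distrib]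
  refine Finset.sum_congr rfl fun a _ => ?_
  simp only [subdiv]
  split_ifs <;> ring

lemma lap_subdiv_inl (f : (G.subdiv m).V → ℤ) (v : G.V) :
    (G.subdiv m).lap f (Sum.inl v) =
      ∑ e, ((if G.src e = v then f (G.chainPt m e 1) - f (G.chainPt m e 0) else 0) -
        (if G.tgt e = v then f (G.chainPt m e (m e + 1)) - f (G.chainPt m e (m e)) else 0)) := by
  rw [lap_subdiv, Finset.sum_sub_distrib]
  congr 1
  · exact Finset.sum_congr rfl fun e _ => sum_chain_src_inl e v
      (fun i => f (G.chainPt m e (i + 1)) - f (G.chainPt m e i))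
  · exact Finset.sum_congr rfl fun e _ => sum_chain_tgt_inl e v
      (fun i => f (G.chainPt m e (i + 1)) - f (G.chainPt m e i))

lemma lap_subdiv_chainPt (f : (G.subdiv m).V → ℤ) {e : G.E} {i : ℕ} (h : i < m e) :
    (G.subdiv m).lap f (G.chainPt m e (i + 1)) =
      (f (G.chainPt m e (i + 2)) - f (G.chainPt m e (i + 1))) -
        (f (G.chainPt m e (i + 1)) - f (G.chainPt m e i)) := by
  have h1 := sum_chain_src_inr h (fun e i => f (G.chainPt m e (i + 1)) - f (G.chainPt m e i))
  have h2 := sum_chain_tgt_inr h (fun e i => f (G.chainPt m e (i + 1)) - f (G.chainPt m e i))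
  rw [← chainPt_inner h] at h1 h2
  rw [lap_subdiv, h1, h2]

lemma can_subdiv (x : (G.subdiv m).V) :
    (G.subdiv m).can x =
      ∑ e, ∑ i ∈ Finset.range (m e + 1), (if G.chainPt m e i = x then (1 : ℤ) else 0) +
      ∑ e, ∑ i ∈ Finset.range (m e + 1), (if G.chainPt m e (i + 1) = x then (1 : ℤ) else 0) -
      2 := by
  rw [← sum_subdiv_E (fun e i => if G.chainPt m e i = x then (1 : ℤ) else 0),
    ← sum_subdiv_E (fun e i => if G.chainPt m e (i + 1) = x then (1 : ℤ) else 0), can,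
    Finset.sum_add_distrib]
  congr 2 <;> exact Finset.sum_congr rfl fun a _ => by congr

lemma can_subdiv_inl (v : G.V) : (G.subdiv m).can (Sum.inl v) = G.can v := by
  rw [can_subdiv, can, Finset.sum_add_distrib]
  congr 2
  · exact Finset.sum_congr rfl fun e _ => sum_chain_src_inl e v (fun _ => 1)
  · exact Finset.sum_congr rfl fun e _ => sum_chain_tgt_inl e v (fun _ => 1)

lemma can_subdiv_inr (a : Σ e, Fin (m e)) : (G.subdiv m).can (Sum.inr a) = 0 := by
  obtain ⟨e, k, hk⟩ := a
  rw [can_subdiv]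
  have h1 := sum_chain_src_inr hk (fun _ _ => 1)
  have h2 := sum_chain_tgt_inr hk (fun _ _ => 1)
  rw [h1, h2]; norm_num

lemma Linked.subdiv (hG : G.Linked) (hinc : ∀ v, ∃ e, G.src e = v ∨ G.tgt e = v) :
    (G.subdiv m).Linked := by
  intro A hne hA
  have step : ∀ e, ∀ i ≤ m e + 1, (G.chainPt m e i ∈ A ↔ G.chainPt m e 0 ∈ A) := by
    intro e i
    induction i with
    | zero => simp
    | succ i ih =>
      intro hi
      rw [← ih (by omega)]
      exact (hA ⟨e, ⟨i, by omega⟩⟩).symm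
  have hV : {v : G.V | (Sum.inl v : G.V ⊕ (Σ e, Fin (m e))) ∈ A} = Set.univ := by
    refine hG _ ?_ fun e => ?_
    · obtain ⟨x, hx⟩ := hne
      obtain ⟨e, i, hi, rfl⟩ := exists_eq_chainPt hinc x
      refine ⟨G.src e, ?_⟩
      have := (step e i hi).1 hx
      rwa [chainPt_zero] at this
    · have := step e (m e + 1) le_rfl
      rw [chainPt_last (by omega), chainPt_zero] at this
      exact this.symm
  ext x
  simp only [Set.mem_univ, iff_true]
  obtain ⟨e, i, hi, rfl⟩ := exists_eq_chainPt hinc x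
  rw [step e i hi, chainPt_zero]
  have : G.src e ∈ (Set.univ : Set G.V) := trivial
  rw [← hV] at this
  exact this

lemma loopless_subdiv (hm : ∀ e, 1 ≤ m e) : (G.subdiv m).Loopless := by
  rintro ⟨e, i, hi⟩ h
  change G.chainPt m e i = G.chainPt m e (i + 1) at h
  have := hm e
  by_cases h1 : i < m e
  · rw [chainPt_inner h1, chainPt_eq_inr] at h
    omega
  · rw [chainPt_last (i := i + 1) (by omega), chainPt_eq_inl] at h
    omega

end Subdivision

end CombGraph

/-! ## Clusters of chips in the canonical class -/

section ConvexSequences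

lemma le_add_mul_of_slope_le {M : ℕ → ℤ} {j d : ℕ} {a : ℤ}
    (h : ∀ k, j ≤ k → k < j + d → M (k + 1) - M k ≤ a) : M (j + d) ≤ M j + d * a := by
  induction d with
  | zero => simp
  | succ d ih =>
    have h1 := ih fun k hk hk' => h k hk (by omega)
    have h2 := h (j + d) (by omega) (by omega)
    rw [← add_assoc]
    push_cast
    linarith

lemma add_mul_le_of_le_slope {M : ℕ → ℤ} {j d : ℕ} {a : ℤ}
    (h : ∀ k, j ≤ k → k < j + d → a ≤ M (k + 1) - M k) : M j + d * a ≤ M (j + d) := by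
  have := le_add_mul_of_slope_le (M := fun k => -M k) (j := j) (d := d) (a := -a)
    fun k hk hk' => by linarith [h k hk hk']
  linarith

/-- If `F ≤ M` are convex with slopes bounded by `C` and agree at `0`, then `M` eventually
catches up with the slope of `F`, at an explicit place. -/
lemma slope_le_slope_of_le {F M : ℕ → ℤ} {n j C : ℕ} (h0 : F 0 = M 0)
    (hle : ∀ k ≤ n, F k ≤ M k) (hF : ∀ k < n, -(C : ℤ) ≤ F (k + 1) - F k)
    (hM : ∀ k < n, M (k + 1) - M k ≤ C)
    (hFc : ∀ k l, k ≤ l → l < n → F (k + 1) - F k ≤ F (l + 1) - F l)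
    (hMc : ∀ k l, 1 ≤ k → k ≤ l → l < n → M (k + 1) - M k ≤ M (l + 1) - M l) (hj : 1 ≤ j)
    (hn : j + 2 * C * j < n) :
    F (j + 1) - F j ≤ M (j + 2 * C * j + 1) - M (j + 2 * C * j) := by
  by_contra! hlt
  set d := 2 * C * j with hd
  have h1 : M (0 + j) ≤ M 0 + j * C :=
    le_add_mul_of_slope_le fun k _ hk => hM k (by omega)
  have h2 : F 0 + j * (-(C : ℤ)) ≤ F (0 + j) :=
    add_mul_le_of_le_slope fun k _ hk => hF k (by omega)
  have h3 : M (j + (d + 1)) ≤ M j + (d + 1 : ℕ) * (F (j + 1) - F j - 1) := by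
    refine le_add_mul_of_slope_le fun k hk hk' => ?_
    have := hMc k (j + d) (by omega) (by omega) (by omega)
    linarith
  have h4 : F j + (d + 1 : ℕ) * (F (j + 1) - F j) ≤ F (j + (d + 1)) :=
    add_mul_le_of_le_slope fun k hk hk' => hFc j k hk (by omega)
  have h5 := hle (j + (d + 1)) (by omega)
  rw [zero_add] at h1 h2
  have h6 : (d : ℤ) = 2 * C * j := by rw [hd]; push_cast; ring
  push_cast at h3 h4
  nlinarith

end ConvexSequences

namespace CombGraph

section Clusters

variable {G : CombGraph}

lemma lap_sup'_nonneg {ι : Type*} [Fintype ι] [Nonempty ι] {D : G.V → ℤ} {f : ι → G.V → ℤ}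
    (hf : ∀ i x, 0 ≤ D x + G.lap (f i) x) (x : G.V) :
    0 ≤ D x + G.lap (fun v => Finset.univ.sup' Finset.univ_nonempty fun i => f i v) x := by
  obtain ⟨i, -, hi⟩ := Finset.exists_mem_eq_sup' Finset.univ_nonempty (fun i => f i x)
  have := lap_le_of_touch (f := f i)
    (m := fun v => Finset.univ.sup' Finset.univ_nonempty fun i => f i v) (x := x)
    (fun v => Finset.le_sup' (fun i => f i v) (Finset.mem_univ i)) hi.symm
  linarith [hf i x]

/-- The indicator of the diagonal. -/
def delta {X : Type*} (a b : X) : ℤ := if a = b then 1 else 0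

@[simp] lemma delta_self {X : Type*} (a : X) : delta a a = 1 := if_pos rfl

lemma delta_of_ne {X : Type*} {a b : X} (h : a ≠ b) : delta a b = 0 := if_neg h

lemma delta_nonneg {X : Type*} (a b : X) : 0 ≤ delta a b := by
  rw [delta]; split_ifs <;> simp

lemma sum_delta {X : Type*} [Fintype X] (a : X) : ∑ x, delta a x = 1 := by
  simp [delta]

/-- An effective divisor with at least `d` chips on `S` dominates `d` chips of `S`. -/
lemma exists_chips {X : Type*} [Fintype X] (d : ℕ) (Q : X → ℤ) (S : Finset X)
    (hQ : ∀ x, 0 ≤ Q x) (hd : (d : ℤ) ≤ ∑ x ∈ S, Q x) :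
    ∃ c : Fin d → X, (∀ j, c j ∈ S) ∧ ∀ x, ∑ j, delta (c j) x ≤ Q x := by
  induction d generalizing Q with
  | zero => exact ⟨fun j => j.elim0, fun j => j.elim0, by simpa using hQ⟩
  | succ d ih =>
    obtain ⟨y, hyS, hy⟩ : ∃ y ∈ S, 0 < Q y := by
      by_contra! hcon
      have := Finset.sum_nonpos hcon
      push_cast at hd
      linarith
    have h0 : ∀ x, 0 ≤ Q x - delta y x := by
      intro x
      by_cases h : y = x
      · subst h
        rw [delta_self]
        linarith
      · simp [delta_of_ne h, hQ x]
    have h1 : (d : ℤ) ≤ ∑ x ∈ S, (Q x - delta y x) := by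
      have : ∑ x ∈ S, delta y x = 1 := by simp [delta, hyS]
      rw [Finset.sum_sub_distrib, this]
      push_cast at hd
      linarith
    obtain ⟨c, hcS, hc⟩ := ih _ h0 h1
    refine ⟨Fin.cons y c, fun j => ?_, fun x => ?_⟩
    · refine Fin.cases ?_ (fun j => ?_) j
      · simpa using hyS
      · simpa using hcS j
    · rw [Fin.sum_univ_succ]
      simp only [Fin.cons_zero, Fin.cons_succ]
      linarith [hc x]

variable {m : G.E → ℕ}

/-- The slope of `f` on the `i`-th segment of the chain over `e`. -/
def slope (m : G.E → ℕ) (f : (G.subdiv m).V → ℤ) (e : G.E) (i : ℕ) : ℤ :=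
  f (G.chainPt m e (i + 1)) - f (G.chainPt m e i)

/-- Membership in the canonical linear system of the subdivision. -/
def InCan (m : G.E → ℕ) (f : (G.subdiv m).V → ℤ) : Prop :=
  ∀ x, 0 ≤ (G.subdiv m).can x + (G.subdiv m).lap f x

lemma abs_slope_le_subdiv {D f : (G.subdiv m).V → ℤ} (h : ∀ x, 0 ≤ D x + (G.subdiv m).lap f x)
    {e : G.E} {i : ℕ} (hi : i ≤ m e) : |slope m f e i| ≤ ∑ x, |D x| :=
  abs_slope_le h (⟨e, ⟨i, by omega⟩⟩ : (G.subdiv m).E)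

lemma InCan.abs_slope_le {f : (G.subdiv m).V → ℤ} (h : InCan m f)
    {e : G.E} {i : ℕ} (hi : i ≤ m e) : |slope m f e i| ≤ ((∑ v, (G.can v).natAbs : ℕ) : ℤ) := by
  refine (abs_slope_le_subdiv h hi).trans (le_of_eq ?_)
  rw [sum_subdiv_V (fun x => |(G.subdiv m).can x|)]
  simp only [can_subdiv_inl, can_subdiv_inr]
  simp

lemma InCan.slope_le_succ {f : (G.subdiv m).V → ℤ} (h : InCan m f)
    {e : G.E} {i : ℕ} (hi : i < m e) : slope m f e i ≤ slope m f e (i + 1) := by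
  have := h (G.chainPt m e (i + 1))
  rw [lap_subdiv_chainPt f hi, chainPt_inner hi, can_subdiv_inr, ← chainPt_inner hi] at this
  simp only [slope]
  linarith

lemma InCan.slope_mono {f : (G.subdiv m).V → ℤ} (h : InCan m f)
    {e : G.E} {i k : ℕ} (hik : i ≤ k) (hk : k ≤ m e) : slope m f e i ≤ slope m f e k := by
  induction k, hik using Nat.le_induction with
  | base => exact le_rfl
  | succ k hik ih => exact (ih (by omega)).trans (h.slope_le_succ (by omega))

lemma InCan.add_const {f : (G.subdiv m).V → ℤ} (h : InCan m f) (c : ℤ) :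
    InCan m (fun x => f x + c) := by
  intro x; rw [lap_add_const]; exact h x

lemma slope_add_const (f : (G.subdiv m).V → ℤ) (c : ℤ) (e : G.E) (i : ℕ) :
    slope m (fun x => f x + c) e i = slope m f e i := by
  simp [slope]

/-- The slope comparison lemma for chains traversed in the increasing direction. -/
lemma InCan.slope_catch_up_right {f h : (G.subdiv m).V → ℤ} (hf : InCan m f) (hh : InCan m h)
    (hle : ∀ x, f x ≤ h x) {e : G.E} {i j C : ℕ} (hC : C = ∑ v, (G.can v).natAbs)
    (heq : f (G.chainPt m e i) = h (G.chainPt m e i)) (hj : 1 ≤ j)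
    (hn : i + (j + 2 * C * j) ≤ m e) :
    slope m f e (i + j) ≤ slope m h e (i + (j + 2 * C * j)) := by
  subst hC
  refine slope_le_slope_of_le (F := fun k => f (G.chainPt m e (i + k)))
    (M := fun k => h (G.chainPt m e (i + k))) (n := m e + 1 - i) heq
    (fun k _ => hle _) (fun k hk => ?_) (fun k hk => ?_) (fun k l hkl hl => ?_)
    (fun k l _ hkl hl => ?_) hj (by omega)
  · exact (abs_le.1 (hf.abs_slope_le (e := e) (i := i + k) (by omega))).1
  · exact (abs_le.1 (hh.abs_slope_le (e := e) (i := i + k) (by omega))).2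
  · exact hf.slope_mono (i := i + k) (k := i + l) (by omega) (by omega)
  · exact hh.slope_mono (i := i + k) (k := i + l) (by omega) (by omega)

/-- The slope comparison lemma for chains traversed backwards from their end. -/
lemma InCan.slope_catch_up_left {f h : (G.subdiv m).V → ℤ} (hf : InCan m f) (hh : InCan m h)
    (hle : ∀ x, f x ≤ h x) {e : G.E} {j C : ℕ} (hC : C = ∑ v, (G.can v).natAbs)
    (heq : f (G.chainPt m e (m e + 1)) = h (G.chainPt m e (m e + 1))) (hj : 1 ≤ j)
    (hn : j + 2 * C * j ≤ m e) :
    slope m h e (m e - (j + 2 * C * j)) ≤ slope m f e (m e - j) := by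
  subst hC
  have key : ∀ (u : (G.subdiv m).V → ℤ) k, k ≤ m e →
      u (G.chainPt m e (m e + 1 - (k + 1))) - u (G.chainPt m e (m e + 1 - k)) =
        -slope m u e (m e - k) := by
    intro u k hk
    rw [slope, show m e + 1 - (k + 1) = m e - k by omega,
      show m e - k + 1 = m e + 1 - k by omega]
    ring
  have := slope_le_slope_of_le (F := fun k => f (G.chainPt m e (m e + 1 - k)))
    (M := fun k => h (G.chainPt m e (m e + 1 - k))) (n := m e + 1) heq
    (fun k _ => hle _) (C := ∑ v, (G.can v).natAbs) (j := j)
    (fun k hk => ?_) (fun k hk => ?_) (fun k l hkl hl => ?_)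
    (fun k l _ hkl hl => ?_) hj (by omega)
  · rw [key f j (by omega), key h _ (by omega)] at this
    linarith
  · rw [key f k (by omega)]
    linarith [(abs_le.1 (hf.abs_slope_le (e := e) (i := m e - k) (by omega))).2]
  · rw [key h k (by omega)]
    linarith [(abs_le.1 (hh.abs_slope_le (e := e) (i := m e - k) (by omega))).1]
  · rw [key f k (by omega), key f l (by omega)]
    exact neg_le_neg (hf.slope_mono (by omega) (by omega))
  · rw [key h k (by omega), key h l (by omega)]
    exact neg_le_neg (hh.slope_mono (by omega) (by omega))

/-- If small balls carry at most `γ` chips of every canonical divisor, a contradiction with the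
genus arises from counting extremal slopes. -/
lemma exists_cluster (hG : (G.subdiv m).Linked) (hl : (G.subdiv m).Loopless) {γ : ℕ}
    (hγ : (Fintype.card G.E : ℤ) - Fintype.card G.V = γ) (hγ1 : 1 ≤ γ) {C L L' : ℕ}
    (hC : C = ∑ v, (G.can v).natAbs) (hL : L = 1 + 2 * C * 1) (hL' : L' = L + 2 * C * L)
    (hm : ∀ e, 2 * L' + 2 ≤ m e) :
    (∃ f, InCan m f ∧ ∃ e i, L ≤ i ∧ i + L ≤ m e ∧
      (γ : ℤ) < slope m f e (i + L) - slope m f e (i - L)) ∨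
    (∃ f, InCan m f ∧ ∃ v, (γ : ℤ) < G.can v + ∑ e, ((if G.src e = v then slope m f e L' else 0) -
      (if G.tgt e = v then slope m f e (m e - L') else 0))) := by
  by_contra! hcon
  obtain ⟨hball, hvert⟩ := hcon
  have hLL' : L ≤ L' := by omega
  have hmL : ∀ e, 2 * L + 2 ≤ m e := fun e => by have := hm e; omega
  have hne : Nonempty G.E := by
    rw [← Fintype.card_pos_iff]; omega
  have hVne : Nonempty (G.subdiv m).V := ⟨Sum.inl (G.src hne.some)⟩
  have hα : ∀ e i, 1 ≤ i → i ≤ m e →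
      ∃ f, InCan m f ∧ (γ : ℤ) ≤ slope m f e i - slope m f e (i - 1) := by
    intro e i hi him
    set x₀ : (G.subdiv m).V := G.chainPt m e i with hx₀
    have hdeg : ∑ x, ((G.subdiv m).can x - γ * if x = x₀ then 1 else 0) =
        (Fintype.card (G.subdiv m).E : ℤ) - Fintype.card (G.subdiv m).V := by
      rw [Finset.sum_sub_distrib, sum_can, ← Finset.mul_sum, card_subdiv, hγ]
      simp
      ring
    have hpos : ∀ x, (0 : ℤ) ≤ γ * if x = x₀ then 1 else 0 := fun x => by positivity
    obtain ⟨f, hf⟩ := exists_effective_of_residual hG hl hVne hdeg ⟨fun _ => 0, fun x => by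
      have : (G.subdiv m).lap (fun _ => 0) x = 0 := by simp [lap]
      rw [this]
      linarith [hpos x]⟩
    refine ⟨f, fun x => by linarith [hf x, hpos x], ?_⟩
    have := hf x₀
    obtain ⟨i, rfl⟩ : ∃ i', i = i' + 1 := ⟨i - 1, by omega⟩
    rw [hx₀, lap_subdiv_chainPt f (by omega), if_pos rfl,
      show (G.subdiv m).can (G.chainPt m e (i + 1)) = 0 by
        rw [chainPt_inner (by omega), can_subdiv_inr]] at this
    simp only [slope, Nat.add_sub_cancel]
    linarith
  obtain ⟨f₀, hf₀⟩ : ∃ f, InCan m f := by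
    obtain ⟨f, hf, -⟩ := hα hne.some 1 le_rfl (by have := hm hne.some; omega)
    exact ⟨f, hf⟩
  have hA : ∀ e i, ∃ a : ℤ, i ≤ m e → (∃ f, InCan m f ∧ slope m f e i = a) ∧
      ∀ f, InCan m f → slope m f e i ≤ a := by
    intro e i
    by_cases hi : i ≤ m e
    · obtain ⟨a, ha, ha'⟩ := Int.exists_greatest_of_bdd
        (P := fun z => ∃ f, InCan m f ∧ slope m f e i = z)
        ⟨C, by rintro z ⟨f, hf, rfl⟩; exact hC ▸ (abs_le.1 (hf.abs_slope_le hi)).2⟩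
        ⟨_, f₀, hf₀, rfl⟩
      exact ⟨a, fun _ => ⟨ha, fun f hf => ha' _ ⟨f, hf, rfl⟩⟩⟩
    · exact ⟨0, fun h => absurd h hi⟩
  have hB : ∀ e i, ∃ b : ℤ, i ≤ m e → (∃ f, InCan m f ∧ -slope m f e i = b) ∧
      ∀ f, InCan m f → -slope m f e i ≤ b := by
    intro e i
    by_cases hi : i ≤ m e
    · obtain ⟨a, ha, ha'⟩ := Int.exists_greatest_of_bdd
        (P := fun z => ∃ f, InCan m f ∧ -slope m f e i = z)
        ⟨C, by
          rintro z ⟨f, hf, rfl⟩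
          have := (abs_le.1 (hf.abs_slope_le hi)).1
          rw [← hC] at this
          linarith⟩
        ⟨_, f₀, hf₀, rfl⟩
      exact ⟨a, fun _ => ⟨ha, fun f hf => ha' _ ⟨f, hf, rfl⟩⟩⟩
    · exact ⟨0, fun h => absurd h hi⟩
  choose A hA using hA
  choose B hB using hB
  have hAB : ∀ e i, 1 ≤ i → i ≤ m e → (γ : ℤ) ≤ A e i + B e (i - 1) := by
    intro e i hi him
    obtain ⟨f, hf, h⟩ := hα e i hi him
    have h1 := (hA e i him).2 f hf
    have h2 := (hB e (i - 1) (by omega)).2 f hf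
    linarith
  have hsep : ∀ e i, L ≤ i → i + L ≤ m e → A e (i + 1) + B e (i - 1) ≤ γ := by
    intro e i hi him
    obtain ⟨f, hf, hfA⟩ := (hA e (i + 1) (by omega)).1
    obtain ⟨h, hh, hhB⟩ := (hB e (i - 1) (by omega)).1
    set f' := fun x => f x + -f (G.chainPt m e i) with hf'
    set h' := fun x => h x + -h (G.chainPt m e i) with hh'
    set M := fun x => max (f' x) (h' x) with hM
    have hMK : InCan m M := lap_max_nonneg (hf.add_const _) (hh.add_const _)
    have h1 : slope m f' e (i + 1) ≤ slope m M e (i + (1 + 2 * C * 1)) :=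
      (hf.add_const _).slope_catch_up_right hMK (fun x => le_max_left _ _) hC
        (by simp [hM, hf', hh']) le_rfl (by omega)
    have h2 : slope m M e (i - 1) ≤ slope m h' e (i - 1) := by
      have e1 : M (G.chainPt m e i) = h' (G.chainPt m e i) := by simp [hM, hf', hh']
      have e2 : h' (G.chainPt m e (i - 1)) ≤ M (G.chainPt m e (i - 1)) := le_max_right _ _
      rw [slope, slope, Nat.sub_add_cancel (by omega)]
      linarith
    have h3 : slope m M e (i - L) ≤ slope m M e (i - 1) := hMK.slope_mono (by omega) (by omega)
    rw [← hL] at h1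
    have h4 := hball M hMK e i hi him
    rw [slope_add_const] at h1 h2
    linarith
  have hmono : ∀ e i, L ≤ i → i + L ≤ m e → B e L ≤ B e i := by
    intro e i hi
    induction i, hi using Nat.le_induction with
    | base => intro _; exact le_rfl
    | succ i hi ih =>
      intro him
      have h1 := hsep e (i + 1) (by omega) (by omega)
      have h2 := hAB e (i + 1 + 1) (by omega) (by omega)
      simp only [Nat.add_sub_cancel] at h1 h2
      linarith [ih (by omega)]
  have hedge : ∀ e, (γ : ℤ) ≤ A e L + B e (m e - L) := by
    intro e
    have h0 := hmL e
    have h1 := hmono e (m e - L) (by omega) (by omega)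
    have h2 := hsep e L le_rfl (by omega)
    have h3 := hAB e L (by omega) (by omega)
    have h4 := hAB e (L + 1) (by omega) (by omega)
    simp only [Nat.add_sub_cancel] at h4
    linarith
  have hv : ∀ v, G.can v + ∑ e, ((if G.src e = v then A e L else 0) +
      (if G.tgt e = v then B e (m e - L) else 0)) ≤ γ := by
    intro v
    choose fA hfA hfA' using fun e => (hA e L (by have := hmL e; omega)).1
    choose fB hfB hfB' using fun e => (hB e (m e - L) (by omega)).1
    set F : G.E × Bool → (G.subdiv m).V → ℤ := fun p x =>
      (if p.2 then fA p.1 else fB p.1) x + -(if p.2 then fA p.1 else fB p.1) (Sum.inl v) with hF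
    have hFK : ∀ p, InCan m (F p) := by
      rintro ⟨e, b⟩
      cases b
      · exact (hfB e).add_const _
      · exact (hfA e).add_const _
    have hF0 : ∀ p, F p (Sum.inl v) = 0 := fun p => by simp [hF]
    set M : (G.subdiv m).V → ℤ :=
      fun x => Finset.univ.sup' Finset.univ_nonempty fun p => F p x with hM
    have hMK : InCan m M := lap_sup'_nonneg hFK
    have hM0 : M (Sum.inl v) = 0 := by simp [hM, hF0]
    have hFM : ∀ p x, F p x ≤ M x := fun p x =>
      Finset.le_sup' (fun p => F p x) (Finset.mem_univ p)
    refine le_trans ?_ (hvert M hMK v)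
    refine add_le_add le_rfl (Finset.sum_le_sum fun e _ => ?_)
    have hme := hm e
    have h1 : G.src e = v → A e L ≤ slope m M e L' := by
      intro hs
      have := (hFK (e, true)).slope_catch_up_right hMK (hFM _) (e := e) (i := 0) (j := L) hC
        (by rw [chainPt_zero, hs, hF0, hM0]) (by omega) (by omega)
      rw [zero_add, zero_add, ← hL'] at this
      refine le_trans (le_of_eq ?_) this
      rw [← hfA' e]
      exact (slope_add_const _ _ _ _).symm
    have h2 : G.tgt e = v → slope m M e (m e - L') ≤ -B e (m e - L) := by
      intro hs
      have := (hFK (e, false)).slope_catch_up_left hMK (hFM _) (e := e) (j := L) hC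
        (by rw [chainPt_last (by omega), hs, hF0, hM0]) (by omega) (by omega)
      rw [← hL'] at this
      refine this.trans (le_of_eq ?_)
      rw [← hfB' e, neg_neg]
      exact slope_add_const _ _ _ _
    split_ifs with a b b
    · linarith [h1 a, h2 b]
    · linarith [h1 a]
    · linarith [h2 b]
    · simp
  have hsum := Finset.sum_le_sum fun v (_ : v ∈ Finset.univ) => hv v
  rw [Finset.sum_add_distrib, sum_can, Finset.sum_comm] at hsum
  simp only [Finset.sum_add_distrib, Finset.sum_ite_eq, Finset.mem_univ, if_true,
    Finset.sum_const, Finset.card_univ, nsmul_eq_mul] at hsum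
  have hE := Finset.sum_le_sum fun e (_ : e ∈ Finset.univ) => hedge e
  simp only [Finset.sum_add_distrib, Finset.sum_const, Finset.card_univ, nsmul_eq_mul] at hE
  have h1 : (1 : ℤ) ≤ γ := by exact_mod_cast hγ1
  nlinarith

end Clusters

end CombGraph

/-! ## Close chips -/

namespace CombGraph

section CloseChips

variable {G : CombGraph}

/-- The position `p` on the chains is at distance at most `R` from the vertex `v`, along its
own chain. -/
def EndClose (m : G.E → ℕ) (R : ℕ) (v : G.V) (p : G.E × ℕ) : Prop :=
  (G.src p.1 = v ∧ p.2 ≤ R) ∨ (G.tgt p.1 = v ∧ m p.1 + 1 ≤ p.2 + R)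

/-- Two positions lie within `R` on the same chain, or are both near a common vertex. -/
def Close (m : G.E → ℕ) (R : ℕ) (p q : G.E × ℕ) : Prop :=
  (p.1 = q.1 ∧ p.2 ≤ q.2 + R ∧ q.2 ≤ p.2 + R) ∨ ∃ v, EndClose m R v p ∧ EndClose m R v q

/-- The divisor on the subdivision given by chips with weights `c` at the positions `p`. -/
def chips (m : G.E → ℕ) {J : Type} [Fintype J] (c : J → ℤ) (p : J → G.E × ℕ)
    (x : (G.subdiv m).V) : ℤ :=
  ∑ j, c j * delta (G.chainPt m (p j).1 (p j).2) x

variable {m : G.E → ℕ}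

lemma sum_chips {J : Type} [Fintype J] (c : J → ℤ) (p : J → G.E × ℕ) :
    ∑ x, chips m c p x = ∑ j, c j := by
  simp only [chips]
  rw [Finset.sum_comm]
  exact Finset.sum_congr rfl fun j _ => by rw [← Finset.mul_sum, sum_delta, mul_one]

lemma sum_range_ite_sub (F : ℕ → ℤ) {a b n : ℕ} (hab : a ≤ b) (hb : b ≤ n) :
    ∑ k ∈ Finset.range n, (if a ≤ k ∧ k < b then F (k + 1) - F k else 0) = F b - F a := by
  rw [← Finset.sum_filter]
  have : (Finset.range n).filter (fun k => a ≤ k ∧ k < b) = Finset.Ico a b := by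
    ext k; simp; omega
  rw [this, Finset.sum_Ico_eq_sub _ hab, Finset.sum_range_sub, Finset.sum_range_sub]
  ring

/-- Summation of a canonical divisor over a set of points of the subdivision. -/
lemma sum_filter_can_lap (f : (G.subdiv m).V → ℤ) (P : G.V → Prop) (Q : G.E → ℕ → Prop) :
    ∑ x : (G.subdiv m).V with Sum.elim P (fun a => Q a.1 a.2) x,
        ((G.subdiv m).can x + (G.subdiv m).lap f x) =
      ∑ v, (if P v then G.can v + ∑ e, ((if G.src e = v then slope m f e 0 else 0) -
        (if G.tgt e = v then slope m f e (m e) else 0)) else 0) +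
      ∑ e, ∑ k ∈ Finset.range (m e), if Q e k then slope m f e (k + 1) - slope m f e k else 0 := by
  rw [Finset.sum_filter, sum_subdiv_V (fun x => if Sum.elim P (fun a => Q a.1 a.2) x then
    (G.subdiv m).can x + (G.subdiv m).lap f x else 0)]
  congr 1
  · refine Finset.sum_congr rfl fun v _ => ?_
    rw [can_subdiv_inl, lap_subdiv_inl]
    rfl
  · refine (Fintype.sum_sigma _).trans (Finset.sum_congr rfl fun e _ => ?_)
    rw [← Fin.sum_univ_eq_sum_range
      (fun k => if Q e k then slope m f e (k + 1) - slope m f e k else 0)]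
    refine Finset.sum_congr rfl fun k _ => ?_
    have h1 : (Sum.inr ⟨e, k⟩ : (G.subdiv m).V) = G.chainPt m e (k + 1) := (chainPt_inner k.2).symm
    have h2 : (G.subdiv m).lap f (Sum.inr ⟨e, k⟩) = slope m f e (k + 1) - slope m f e k := by
      rw [h1]
      exact lap_subdiv_chainPt f k.2
    rw [can_subdiv_inr, h2, zero_add]
    rfl

lemma Close.of_endClose {R : ℕ} {v : G.V} {p q : G.E × ℕ} (hp : EndClose m R v p)
    (hq : EndClose m R v q) : Close m R p q := Or.inr ⟨v, hp, hq⟩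

lemma exists_chips_of_close {γ R : ℕ} {f : (G.subdiv m).V → ℤ} (hf : InCan m f)
    {S : Finset (G.subdiv m).V}
    (hS : ((γ + 1 : ℕ) : ℤ) ≤ ∑ x ∈ S, ((G.subdiv m).can x + (G.subdiv m).lap f x))
    {T : Set (G.E × ℕ)} (hT : ∀ p ∈ T, ∀ q ∈ T, Close m R p q)
    (hST : ∀ x ∈ S, ∃ p ∈ T, p.2 ≤ m p.1 + 1 ∧ x = G.chainPt m p.1 p.2) :
    ∃ a : Fin (γ + 1) → G.E × ℕ, (∀ j, (a j).2 ≤ m (a j).1 + 1) ∧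
      (∀ j k, Close m R (a j) (a k)) ∧
      ∃ f, ∀ x, 0 ≤ (G.subdiv m).can x - chips m (fun _ => 1) a x + (G.subdiv m).lap f x := by
  obtain ⟨c, hcS, hc⟩ := exists_chips (γ + 1) _ S hf hS
  choose a haT ha hca using fun j => hST (c j) (hcS j)
  refine ⟨a, ha, fun j k => hT _ (haT j) _ (haT k), f, fun x => ?_⟩
  have : chips m (fun _ => 1) a x = ∑ j, delta (c j) x := by
    simp only [chips, ← hca, one_mul]
  rw [this]
  linarith [hc x]

/-- On fine subdivisions some canonical divisor contains `g` chips close to each other. -/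
lemma exists_close_chips (hG : G.Linked) (hinc : ∀ v, ∃ e, G.src e = v ∨ G.tgt e = v) {γ : ℕ}
    (hγ : (Fintype.card G.E : ℤ) - Fintype.card G.V = γ) (hγ1 : 1 ≤ γ) :
    ∃ R, ∀ m : G.E → ℕ, (∀ e, R ≤ m e) → ∃ a : Fin (γ + 1) → G.E × ℕ,
      (∀ j, (a j).2 ≤ m (a j).1 + 1) ∧ (∀ j k, Close m R (a j) (a k)) ∧
      ∃ f, ∀ x, 0 ≤ (G.subdiv m).can x - chips m (fun _ => 1) a x + (G.subdiv m).lap f x := by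
  obtain ⟨C, hC⟩ : ∃ C, C = ∑ v, (G.can v).natAbs := ⟨_, rfl⟩
  obtain ⟨L, hL⟩ : ∃ L, L = 1 + 2 * C * 1 := ⟨_, rfl⟩
  obtain ⟨L', hL'⟩ : ∃ L', L' = L + 2 * C * L := ⟨_, rfl⟩
  have hLL' : L ≤ L' := by omega
  refine ⟨2 * L' + 2, fun m hm => ?_⟩
  rcases exists_cluster (hG.subdiv hinc) (loopless_subdiv fun e => by have := hm e; omega) hγ hγ1
    hC hL hL' hm with ⟨f, hf, e, i, hi, him, h⟩ | ⟨f, hf, v, h⟩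
  · refine exists_chips_of_close hf
      (S := Finset.univ.filter (Sum.elim (fun _ => False) fun b =>
        b.1 = e ∧ i - L ≤ (b.2 : ℕ) ∧ (b.2 : ℕ) < i + L))
      (T := {p | p.1 = e ∧ i - L ≤ p.2 ∧ p.2 ≤ i + L}) ?_ ?_ ?_
    · rw [sum_filter_can_lap f (fun _ => False)
        (fun e' k => e' = e ∧ i - L ≤ k ∧ k < i + L), Finset.sum_eq_single e]
      · simp only [true_and, if_false, Finset.sum_const_zero, zero_add]
        rw [sum_range_ite_sub (slope m f e) (by omega) him]
        push_cast
        linarith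
      · intro e' _ he'
        simp [he']
      · simp
    · rintro ⟨e₁, i₁⟩ ⟨h1, h2, h3⟩ ⟨e₂, i₂⟩ ⟨h4, h5, h6⟩
      dsimp only at *
      subst h1 h4
      exact Or.inl ⟨rfl, by dsimp only; omega, by dsimp only; omega⟩
    · rintro (w | ⟨e', k, hk⟩) hx
      · simp at hx
      · obtain ⟨h1, h2, h3⟩ : e' = e ∧ i - L ≤ k ∧ k < i + L := by simpa using hx
        exact ⟨(e', k + 1), ⟨h1, by dsimp only; omega, by dsimp only; omega⟩, by dsimp only; omega,
          (chainPt_inner hk).symm⟩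
  · refine exists_chips_of_close hf
      (S := Finset.univ.filter (Sum.elim (fun w => w = v) fun b =>
        (G.src b.1 = v ∧ (b.2 : ℕ) < L') ∨ (G.tgt b.1 = v ∧ m b.1 - L' ≤ (b.2 : ℕ))))
      (T := {p | EndClose m (2 * L' + 2) v p}) ?_ ?_ ?_
    · rw [sum_filter_can_lap f (fun w => w = v)
        (fun e k => (G.src e = v ∧ k < L') ∨ (G.tgt e = v ∧ m e - L' ≤ k)),
        Finset.sum_eq_single v (fun w _ hw => if_neg hw) (by simp), if_pos rfl, add_assoc,
        ← Finset.sum_add_distrib]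
      push_cast
      refine (Int.add_one_le_iff.2 h).trans (le_of_eq ?_)
      congr 1
      refine Finset.sum_congr rfl fun e _ => ?_
      have hme := hm e
      have h1 := sum_range_ite_sub (slope m f e) (a := 0) (b := L') (n := m e) (by omega)
        (by omega)
      have h2 := sum_range_ite_sub (slope m f e) (a := m e - L') (b := m e) (n := m e) (by omega)
        (by omega)
      have h3 : ∀ k ∈ Finset.range (m e),
          (if (G.src e = v ∧ k < L') ∨ (G.tgt e = v ∧ m e - L' ≤ k) then
            slope m f e (k + 1) - slope m f e k else 0) =
          (if G.src e = v then 1 else 0) * (if 0 ≤ k ∧ k < L' then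
            slope m f e (k + 1) - slope m f e k else 0) +
          (if G.tgt e = v then 1 else 0) * (if m e - L' ≤ k ∧ k < m e then
            slope m f e (k + 1) - slope m f e k else 0) := by
        intro k hk
        have := Finset.mem_range.1 hk
        by_cases a1 : G.src e = v <;> by_cases a2 : G.tgt e = v <;> by_cases a3 : k < L' <;>
          by_cases a4 : m e - L' ≤ k <;> simp [a1, a2, a3, a4, this]
        omega
      have h4 := Finset.sum_congr rfl h3
      rw [Finset.sum_add_distrib, ← Finset.mul_sum, ← Finset.mul_sum, h1, h2] at h4
      trans ((if G.src e = v then slope m f e 0 else 0) -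
        (if G.tgt e = v then slope m f e (m e) else 0)) +
        ((if G.src e = v then 1 else 0) * (slope m f e L' - slope m f e 0) +
        (if G.tgt e = v then 1 else 0) * (slope m f e (m e) - slope m f e (m e - L')))
      · split_ifs <;> ring
      · rw [← h4]
        congr!
    · exact fun p hp q hq => Close.of_endClose hp hq
    · rintro (w | ⟨e, k, hk⟩) hx
      · obtain rfl : w = v := by simpa using hx
        obtain ⟨e, he | he⟩ := hinc w
        · exact ⟨(e, 0), Or.inl ⟨he, by simp⟩, by simp, by simp [he]⟩
        · exact ⟨(e, m e + 1), Or.inr ⟨he, by dsimp only; omega⟩, le_rfl,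
            by rw [chainPt_last (by simp), he]⟩
      · have hx' : (G.src e = v ∧ k < L') ∨ (G.tgt e = v ∧ m e - L' ≤ k) := by simpa using hx
        refine ⟨(e, k + 1), ?_, by dsimp only; omega, (chainPt_inner hk).symm⟩
        rcases hx' with ⟨h1, h2⟩ | ⟨h1, h2⟩
        · exact Or.inl ⟨h1, by dsimp only; omega⟩
        · exact Or.inr ⟨h1, by dsimp only; omega⟩

/-- A residual class allows one to move the chips of `a` onto any prescribed position. -/
lemma exists_moved_chips (hG : G.Linked) (hinc : ∀ v, ∃ e, G.src e = v ∨ G.tgt e = v) {γ : ℕ}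
    (hγ : (Fintype.card G.E : ℤ) - Fintype.card G.V = γ) (hm : ∀ e, 1 ≤ m e)
    {a : Fin (γ + 1) → G.E × ℕ}
    (ha : ∃ f, ∀ x, 0 ≤ (G.subdiv m).can x - chips m (fun _ => 1) a x + (G.subdiv m).lap f x)
    (y : G.E × ℕ) :
    ∃ (b : Fin γ → G.E × ℕ) (f : (G.subdiv m).V → ℤ),
      (∀ j, (b j).2 ≤ m (b j).1 + 1) ∧ (∀ e i, i ≤ m e → |slope m f e i| ≤ γ + 2) ∧
      ∀ x, (G.subdiv m).lap f x = chips m (Sum.elim (fun _ => 1) (fun _ => -1))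
        (Sum.elim a (fun o : Option (Fin γ) => o.elim y b)) x := by
  have hV : Nonempty (G.subdiv m).V := ⟨G.chainPt m y.1 y.2⟩
  set P := chips m (fun _ => 1) a with hP
  set Y : (G.subdiv m).V → ℤ := fun x => delta (G.chainPt m y.1 y.2) x with hY
  have hYs : ∑ x, Y x = 1 := sum_delta _
  have hY0 : ∀ x, 0 ≤ Y x := fun x => delta_nonneg _ _
  have hPs : ∑ x, P x = γ + 1 := by
    rw [hP, sum_chips]; simp
  have hP0 : ∀ x, 0 ≤ P x := fun x => Finset.sum_nonneg fun j _ => by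
    simpa using delta_nonneg _ _
  obtain ⟨f₀, hf₀⟩ := ha
  obtain ⟨h, hh⟩ := exists_effective_of_residual (hG.subdiv hinc) (loopless_subdiv hm) hV
    (D := fun x => P x - Y x)
    (by rw [Finset.sum_sub_distrib, hPs, hYs, card_subdiv, hγ]; ring)
    ⟨f₀, fun x => by linarith [hf₀ x, hY0 x]⟩
  have hBs : ∑ x, (P x - Y x + (G.subdiv m).lap h x) = γ := by
    rw [Finset.sum_add_distrib, Finset.sum_sub_distrib, hPs, hYs, sum_lap]; ring
  obtain ⟨c, -, hc⟩ := exists_chips γ _ Finset.univ hh hBs.ge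
  choose! e i hi hei using fun x : (G.subdiv m).V => exists_eq_chainPt (m := m) hinc x
  have hc' : ∀ x, ∑ j, delta (c j) x = P x - Y x + (G.subdiv m).lap h x := by
    have hs : ∑ x, ∑ j, delta (c j) x = γ := by
      rw [Finset.sum_comm]
      simp [sum_delta]
    have := (Finset.sum_eq_sum_iff_of_le fun x _ => hc x).1 (hs.trans hBs.symm)
    exact fun x => this x (Finset.mem_univ x)
  refine ⟨fun j => (e (c j), i (c j)), fun x => (-1) * h x, fun j => hi _, fun e i hi => ?_,
    fun x => ?_⟩
  · have h1 := abs_slope_le_subdiv hh hi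
    have h2 : slope m (fun x => (-1) * h x) e i = -slope m h e i := by simp only [slope]; ring
    rw [h2, abs_neg]
    refine h1.trans ((Finset.sum_le_sum fun x _ => abs_sub (P x) (Y x)).trans (le_of_eq ?_))
    rw [Finset.sum_add_distrib, Finset.sum_congr rfl fun x _ => abs_of_nonneg (hP0 x),
      Finset.sum_congr rfl fun x _ => abs_of_nonneg (hY0 x), hPs, hYs]
    ring
  · rw [lap_mul]
    have h1 := hc' x
    have h2 : ∑ j, delta (c j) x =
        ∑ j, delta (G.chainPt m (e (c j)) (i (c j))) x := by
      simp only [← hei]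
    simp only [chips, Fintype.sum_sum_type, Sum.elim_inl, Sum.elim_inr, Fintype.sum_option,
      Option.elim_none, Option.elim_some, neg_one_mul, one_mul, Finset.sum_neg_distrib]
    rw [← h2, h1, hP, hY]
    simp only [chips, one_mul]
    ring

end CloseChips

end CombGraph

/-! ## Principal configurations of weighted chips -/

namespace CombGraph

open Filter Topology

section EdgeRel

variable {G : CombGraph} {J : Type} [Fintype J]

/-- The chips of weight `c j` at coordinate `t j` on the edge `e j` form the divisor of a function
which has slope `s a` before the first chip of the edge `a`, for the edge lengths `L`. -/
structure EdgeRel (G : CombGraph) (L : G.E → ℝ) (c : J → ℤ) (e : J → G.E) (t : J → ℝ)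
    (s : G.E → ℤ) : Prop where
  nonneg : ∀ j, 0 ≤ t j
  le_len : ∀ j, t j ≤ L (e j)
  potential : ∃ φ : G.V → ℝ, ∀ a, φ (G.tgt a) - φ (G.src a) =
    s a * L a + ∑ j, if e j = a then c j * (L a - t j) else 0
  vertex : ∀ v, ∑ a, ((if G.src a = v then s a else 0) -
    (if G.tgt a = v then s a + ∑ j, (if e j = a then c j else 0) else 0)) = 0

lemma EdgeRel.smul {L : G.E → ℝ} {c : J → ℤ} {e : J → G.E} {t : J → ℝ} {s : G.E → ℤ}
    (h : G.EdgeRel L c e t s) {r : ℝ} (hr : 0 ≤ r) :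
    G.EdgeRel (fun a => r * L a) c e (fun j => r * t j) s where
  nonneg j := mul_nonneg hr (h.nonneg j)
  le_len j := mul_le_mul_of_nonneg_left (h.le_len j) hr
  potential := by
    obtain ⟨φ, hφ⟩ := h.potential
    refine ⟨fun v => r * φ v, fun a => ?_⟩
    rw [← mul_sub, hφ, mul_add, Finset.mul_sum]
    congr 1
    · ring
    · refine Finset.sum_congr rfl fun j _ => ?_
      split_ifs <;> ring
  vertex := h.vertex

lemma slope_eq_of_lap {m : G.E → ℕ} {c : J → ℤ} {p : J → G.E × ℕ} {f : (G.subdiv m).V → ℤ}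
    (hf : ∀ x, (G.subdiv m).lap f x = chips m c p x) (a : G.E) {k : ℕ} (hk : k ≤ m a) :
    slope m f a k = slope m f a 0 - (∑ j, if (p j).1 = a ∧ (p j).2 = 0 then c j else 0) +
      ∑ j, if (p j).1 = a ∧ (p j).2 ≤ k then c j else 0 := by
  induction k with
  | zero => simp
  | succ k ih =>
    have h1 := hf (G.chainPt m a (k + 1))
    rw [lap_subdiv_chainPt f hk, chips] at h1
    have h2 : slope m f a (k + 1) = slope m f a k +
        ∑ j, if (p j).1 = a ∧ (p j).2 = k + 1 then c j else 0 := by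
      simp only [chainPt_inner hk, delta, chainPt_eq_inr, mul_ite, mul_one, mul_zero] at h1
      rw [← h1, ← chainPt_inner hk]
      simp only [slope]
      ring
    rw [h2, ih (by omega), add_assoc, ← Finset.sum_add_distrib]
    congr 1
    refine Finset.sum_congr rfl fun j _ => ?_
    by_cases h3 : (p j).1 = a
    · by_cases h4 : (p j).2 ≤ k
      · rw [if_pos ⟨h3, h4⟩, if_neg (by omega), if_pos ⟨h3, by omega⟩, add_zero]
      · by_cases h5 : (p j).2 = k + 1
        · rw [if_neg (by omega), if_pos ⟨h3, h5⟩, if_pos ⟨h3, by omega⟩, zero_add]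
        · rw [if_neg (by omega), if_neg (by omega), if_neg (by omega), zero_add]
    · simp [h3]

lemma exists_edgeRel_of_lap {m : G.E → ℕ} {c : J → ℤ} {p : J → G.E × ℕ}
    (hp : ∀ j, (p j).2 ≤ m (p j).1 + 1) {f : (G.subdiv m).V → ℤ}
    (hf : ∀ x, (G.subdiv m).lap f x = chips m c p x) {B : ℤ}
    (hB : ∀ e i, i ≤ m e → |slope m f e i| ≤ B) :
    ∃ s : G.E → ℤ, (∀ a, |s a| ≤ B + ∑ j, |c j|) ∧
      G.EdgeRel (fun a => (m a : ℝ) + 1) c (fun j => (p j).1) (fun j => (p j).2) s := by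
  set s : G.E → ℤ := fun a => slope m f a 0 - ∑ j, if (p j).1 = a ∧ (p j).2 = 0 then c j else 0
    with hs
  have hslope : ∀ a k, k ≤ m a → slope m f a k =
      s a + ∑ j, if (p j).1 = a ∧ (p j).2 ≤ k then c j else 0 :=
    fun a k hk => slope_eq_of_lap hf a hk
  refine ⟨s, fun a => ?_, fun j => Nat.cast_nonneg _, fun j => by exact_mod_cast hp j,
    ⟨fun v => f (Sum.inl v), fun a => ?_⟩, fun v => ?_⟩
  · refine (abs_sub _ _).trans (add_le_add (hB a 0 (Nat.zero_le _)) ?_)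
    refine (Finset.abs_sum_le_sum_abs _ _).trans (Finset.sum_le_sum fun j _ => ?_)
    split_ifs <;> simp
  · have h1 : f (Sum.inl (G.tgt a)) - f (Sum.inl (G.src a)) =
        s a * (m a + 1) + ∑ j, if (p j).1 = a then c j * ((m a + 1) - (p j).2) else 0 := by
      have h2 : ∑ k ∈ Finset.range (m a + 1), slope m f a k =
          f (Sum.inl (G.tgt a)) - f (Sum.inl (G.src a)) := by
        have := Finset.sum_range_sub (fun k => f (G.chainPt m a k)) (m a + 1)
        rwa [chainPt_last (i := m a + 1) (by omega), chainPt_zero] at this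
      rw [← h2, Finset.sum_congr rfl fun k hk => hslope a k (by simpa [Nat.lt_succ_iff] using hk),
        Finset.sum_add_distrib, Finset.sum_comm]
      congr 1
      · simp; ring
      · refine Finset.sum_congr rfl fun j _ => ?_
        by_cases h3 : (p j).1 = a
        · have h4 := hp j
          rw [h3] at h4
          have h5 : (Finset.range (m a + 1)).filter (fun k => (p j).2 ≤ k) =
              Finset.Ico (p j).2 (m a + 1) := by
            ext k; simp; omega
          simp only [h3, true_and, if_true]
          rw [← Finset.sum_filter, h5, Finset.sum_const, Nat.card_Ico, nsmul_eq_mul,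
            Nat.cast_sub h4]
          push_cast
          ring
        · simp [h3]
    have h6 := congrArg (fun z : ℤ => (z : ℝ)) h1
    push_cast at h6
    rw [h6]
  · have h1 := hf (Sum.inl v)
    rw [lap_subdiv_inl, chips] at h1
    have h2 : ∑ j, c j * delta (G.chainPt m (p j).1 (p j).2) (Sum.inl v) =
        ∑ a, ∑ j, if (p j).1 = a then
          (if (p j).2 = 0 ∧ G.src a = v ∨ m a < (p j).2 ∧ G.tgt a = v then c j else 0) else 0 := by
      rw [Finset.sum_comm]
      refine Finset.sum_congr rfl fun j _ => ?_
      rw [Finset.sum_ite_eq, if_pos (Finset.mem_univ _), delta]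
      simp only [chainPt_eq_inl, mul_ite, mul_one, mul_zero]
    rw [h2, ← sub_eq_zero, ← Finset.sum_sub_distrib] at h1
    refine Eq.trans (Finset.sum_congr rfl fun a _ => ?_) h1
    have h3 : f (G.chainPt m a 1) - f (G.chainPt m a 0) = slope m f a 0 := rfl
    have h4 : f (G.chainPt m a (m a + 1)) - f (G.chainPt m a (m a)) = slope m f a (m a) := rfl
    have h5 : ∑ j, (if (p j).1 = a then
        (if (p j).2 = 0 ∧ G.src a = v ∨ m a < (p j).2 ∧ G.tgt a = v then c j else 0) else 0) =
        (if G.src a = v then ∑ j, (if (p j).1 = a ∧ (p j).2 ≤ 0 then c j else 0) else 0) +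
        (if G.tgt a = v then ∑ j, (if (p j).1 = a then c j else 0) -
          ∑ j, (if (p j).1 = a ∧ (p j).2 ≤ m a then c j else 0) else 0) := by
      rw [← Finset.sum_sub_distrib]
      have h6 : ∀ (P : Prop) (F : J → ℤ), (if P then ∑ j, F j else 0) =
          ∑ j, if P then F j else 0 := fun P F => by split_ifs <;> simp
      rw [h6, h6, ← Finset.sum_add_distrib]
      refine Finset.sum_congr rfl fun j _ => ?_
      by_cases a1 : (p j).1 = a <;> by_cases a2 : G.src a = v <;> by_cases a3 : G.tgt a = v <;>
        by_cases a4 : (p j).2 = 0 <;> by_cases a5 : (p j).2 ≤ m a <;>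
        simp [a1, a2, a3, a4, a5, not_lt.2, not_le.1]
    rw [h3, h4, h5, hslope a 0 (Nat.zero_le _), hslope a (m a) le_rfl]
    split_ifs <;> ring

lemma exists_eventually_eq {X : Type*} (U : Ultrafilter ℕ) {S : Set X} (hS : S.Finite)
    (u : ℕ → X) (hu : ∀ᶠ n in (U : Filter ℕ), u n ∈ S) :
    ∃ x ∈ S, ∀ᶠ n in (U : Filter ℕ), u n = x := by
  have h : ⋃ x ∈ S, {n | u n = x} ∈ U := by
    filter_upwards [hu] with n hn
    simpa using hn
  obtain ⟨x, hx, h⟩ := (Ultrafilter.finite_biUnion_mem_iff hS).1 h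
  exact ⟨x, hx, h⟩

lemma exists_tendsto_of_mem_Icc (U : Ultrafilter ℕ) {u : ℕ → ℝ} {a b : ℝ}
    (hu : ∀ᶠ n in (U : Filter ℕ), u n ∈ Set.Icc a b) :
    ∃ x, Tendsto u U (𝓝 x) := by
  obtain ⟨x, -, hx⟩ := (isCompact_Icc (a := a) (b := b)).ultrafilter_le_nhds (U.map u)
    (le_principal_iff.2 hu)
  exact ⟨x, hx⟩

/-- Principal configurations with bounded slopes are stable under limits. -/
lemma EdgeRel.exists_limit (U : Ultrafilter ℕ) {Ln : ℕ → G.E → ℝ} {L : G.E → ℝ}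
    (hL : ∀ a, Tendsto (fun n => Ln n a) U (𝓝 (L a))) {c : J → ℤ} {en : ℕ → J → G.E}
    {tn : ℕ → J → ℝ} {B : ℤ}
    (h : ∀ᶠ n in (U : Filter ℕ), ∃ s : G.E → ℤ, (∀ a, |s a| ≤ B) ∧
      G.EdgeRel (Ln n) c (en n) (tn n) s) :
    ∃ e t s, G.EdgeRel L c e t s ∧ (∀ᶠ n in (U : Filter ℕ), en n = e) ∧
      ∀ j, Tendsto (fun n => tn n j) U (𝓝 (t j)) := by
  have h' : ∀ n, ∃ s : G.E → ℤ, (∃ s : G.E → ℤ, (∀ a, |s a| ≤ B) ∧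
      G.EdgeRel (Ln n) c (en n) (tn n) s) → (∀ a, |s a| ≤ B) ∧
      G.EdgeRel (Ln n) c (en n) (tn n) s := fun n => by
    by_cases hn : ∃ s : G.E → ℤ, (∀ a, |s a| ≤ B) ∧ G.EdgeRel (Ln n) c (en n) (tn n) s
    · obtain ⟨s, hs⟩ := hn
      exact ⟨s, fun _ => hs⟩
    · exact ⟨0, fun h => absurd h hn⟩
  choose sn hsn using h'
  have hrel : ∀ᶠ n in (U : Filter ℕ), (∀ a, |sn n a| ≤ B) ∧
      G.EdgeRel (Ln n) c (en n) (tn n) (sn n) := h.mono fun n hn => hsn n hn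
  obtain ⟨e, -, he⟩ := exists_eventually_eq U (Set.finite_univ (α := J → G.E)) en
    (Eventually.of_forall fun _ => trivial)
  obtain ⟨s, -, hs⟩ := exists_eventually_eq U
    (Set.Finite.pi' fun _ : G.E => Set.finite_Icc (-B) B) sn
    (hrel.mono fun n hn a => abs_le.1 (hn.1 a))
  have ht : ∀ j, ∃ x, Tendsto (fun n => tn n j) U (𝓝 x) := fun j => by
    refine exists_tendsto_of_mem_Icc U (a := 0) (b := L (e j) + 1) ?_
    filter_upwards [hrel, he, (hL (e j)).eventually_le_const (lt_add_one _)] with n h1 h2 h3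
    refine ⟨h1.2.nonneg j, (h1.2.le_len j).trans ?_⟩
    rwa [h2]
  choose t ht using ht
  have hrel' : ∀ᶠ n in (U : Filter ℕ), G.EdgeRel (Ln n) c e (tn n) s := by
    filter_upwards [hrel, he, hs] with n h1 h2 h3
    rw [← h2, ← h3]
    exact h1.2
  refine ⟨e, t, s, ⟨fun j => ?_, fun j => ?_, ?_, ?_⟩, he, ht⟩
  · exact ge_of_tendsto (ht j) (hrel'.mono fun n hn => hn.nonneg j)
  · exact le_of_tendsto_of_tendsto (ht j) (hL (e j)) (hrel'.mono fun n hn => hn.le_len j)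
  · let T : (G.V → ℝ) →ₗ[ℝ] (G.E → ℝ) :=
      { toFun := fun φ a => φ (G.tgt a) - φ (G.src a)
        map_add' := fun φ ψ => by ext a; simp; ring
        map_smul' := fun r φ => by ext a; simp; ring }
    have hcl : IsClosed (LinearMap.range T : Set (G.E → ℝ)) :=
      Submodule.closed_of_finiteDimensional _
    have hlim : Tendsto (fun n (a : G.E) => (s a : ℝ) * Ln n a +
        ∑ j, if e j = a then (c j : ℝ) * (Ln n a - tn n j) else 0) U
        (𝓝 fun a => (s a : ℝ) * L a + ∑ j, if e j = a then (c j : ℝ) * (L a - t j) else 0) := by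
      refine tendsto_pi_nhds.2 fun a => ((hL a).const_mul _).add (tendsto_finsetSum _ fun j _ => ?_)
      split_ifs
      · exact ((hL a).sub (ht j)).const_mul _
      · exact tendsto_const_nhds
    obtain ⟨φ, hφ⟩ := hcl.mem_of_tendsto hlim (hrel'.mono fun n hn => by
      obtain ⟨φ, hφ⟩ := hn.potential
      exact ⟨φ, funext hφ⟩)
    exact ⟨φ, fun a => congrFun hφ a⟩
  · obtain ⟨n, hn⟩ := hrel'.exists
    exact hn.vertex

end EdgeRel

end CombGraph

/-! ## Points of the realization and rational functions in hinge form -/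

namespace CombGraph

open Filter Topology

section Points

variable {G : CombGraph}

lemma clamp_of_mem {a : G.E} {u : ℝ} (h0 : 0 ≤ u) (h1 : u ≤ G.len a) : G.clamp a u = u := by
  rw [clamp, min_eq_left h1, max_eq_right h0]

lemma edgePt_zero (a : G.E) : G.edgePt a 0 = G.vertexPt (G.src a) := by
  have h := clamp_of_mem le_rfl (G.len_pos a).le
  simp only [edgePt, h]
  exact (Quot.sound (Glue.srcGlue a)).symm

lemma edgePt_len (a : G.E) : G.edgePt a (G.len a) = G.vertexPt (G.tgt a) := by
  have h := clamp_of_mem (G.len_pos a).le le_rfl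
  simp only [edgePt, h]
  exact (Quot.sound (Glue.tgtGlue a)).symm

lemma eq_vertexPt_or_edgePt (x : G.Space) :
    (∃ v, x = G.vertexPt v) ∨ ∃ a u, 0 < u ∧ u < G.len a ∧ x = G.edgePt a u := by
  obtain ⟨⟨v | ⟨a, u⟩, hp⟩, rfl⟩ := Quot.exists_rep x
  · exact Or.inl ⟨v, rfl⟩
  · have hu : 0 ≤ u ∧ u ≤ G.len a := hp
    obtain ⟨h0, h1⟩ := hu
    have hx : (Quot.mk _ ⟨Sum.inr (a, u), hp⟩ : G.Space) = G.edgePt a u := by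
      simp only [edgePt, clamp_of_mem h0 h1]
    rcases h0.eq_or_lt with rfl | h0
    · exact Or.inl ⟨_, hx.trans (edgePt_zero a)⟩
    rcases h1.eq_or_lt with rfl | h1
    · exact Or.inl ⟨_, hx.trans (edgePt_len a)⟩
    · exact Or.inr ⟨a, u, h0, h1, hx⟩

/-- The map on the realization induced by compatible maps on vertices and edges. -/
def glueMap {X : Type*} (F : G.V → X) (φ : G.E → ℝ → X) (h0 : ∀ a, φ a 0 = F (G.src a))
    (h1 : ∀ a, φ a (G.len a) = F (G.tgt a)) : G.Space → X :=
  Quot.lift (fun p => Sum.elim F (fun q => φ q.1 q.2) p.1) (by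
    rintro _ _ (a | a)
    · exact (h0 a).symm
    · exact (h1 a).symm)

section GlueMap

variable {X : Type*} {F : G.V → X} {φ : G.E → ℝ → X} {h0 : ∀ a, φ a 0 = F (G.src a)}
  {h1 : ∀ a, φ a (G.len a) = F (G.tgt a)}

lemma glueMap_edgePt {a : G.E} {u : ℝ} (hu0 : 0 ≤ u) (hu1 : u ≤ G.len a) :
    glueMap F φ h0 h1 (G.edgePt a u) = φ a u :=
  congrArg (φ a) (clamp_of_mem hu0 hu1)

lemma continuous_glueMap [TopologicalSpace X] (hφ : ∀ a, Continuous (φ a)) :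
    Continuous (glueMap F φ h0 h1) := by
  have : DiscreteTopology G.V := ⟨rfl⟩
  have : DiscreteTopology G.E := ⟨rfl⟩
  refine continuous_quot_lift _ ?_
  have h : Continuous (Sum.elim F fun q : G.E × ℝ => φ q.1 q.2) :=
    continuous_of_discreteTopology.sumElim (continuous_prod_of_discrete_left.2 hφ)
  exact h.comp continuous_subtype_val

end GlueMap

/-- The normal form of a point of the realization: a vertex or an interior point of an edge. -/
def normalForm : G.Space → G.V ⊕ (G.E × ℝ) :=
  glueMap Sum.inl (fun a u => if u ≤ 0 then Sum.inl (G.src a) else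
    if G.len a ≤ u then Sum.inl (G.tgt a) else Sum.inr (a, u)) (fun a => by simp)
    (fun a => by rw [if_neg (G.len_pos a).not_ge, if_pos le_rfl])

lemma normalForm_vertexPt (v : G.V) : normalForm (G.vertexPt v) = Sum.inl v := rfl

lemma normalForm_edgePt {a : G.E} {u : ℝ} (hu0 : 0 ≤ u) (hu1 : u ≤ G.len a) :
    normalForm (G.edgePt a u) = if u ≤ 0 then Sum.inl (G.src a) else
      if G.len a ≤ u then Sum.inl (G.tgt a) else Sum.inr (a, u) :=
  glueMap_edgePt hu0 hu1

lemma vertexPt_injective : Function.Injective G.vertexPt := fun _ _ h =>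
  Sum.inl_injective (congrArg normalForm h)

lemma edgePt_eq_vertexPt {a : G.E} {u : ℝ} (hu0 : 0 ≤ u) (hu1 : u ≤ G.len a) {v : G.V} :
    G.edgePt a u = G.vertexPt v ↔ (u ≤ 0 ∧ G.src a = v) ∨ (G.len a ≤ u ∧ G.tgt a = v) := by
  constructor
  · intro h
    have h' := congrArg normalForm h
    rw [normalForm_edgePt hu0 hu1, normalForm_vertexPt] at h'
    split_ifs at h' with h1 h2
    · exact Or.inl ⟨h1, Sum.inl_injective h'⟩
    · exact Or.inr ⟨h2, Sum.inl_injective h'⟩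
  · rintro (⟨h, rfl⟩ | ⟨h, rfl⟩)
    · rw [le_antisymm h hu0, edgePt_zero]
    · rw [le_antisymm hu1 h, edgePt_len]

lemma edgePt_eq_edgePt {a b : G.E} {u w : ℝ} (hu0 : 0 ≤ u) (hu1 : u ≤ G.len a) (hw0 : 0 < w)
    (hw1 : w < G.len b) : G.edgePt a u = G.edgePt b w ↔ a = b ∧ u = w := by
  constructor
  · intro h
    have h' := congrArg normalForm h
    rw [normalForm_edgePt hu0 hu1, normalForm_edgePt hw0.le hw1.le, if_neg hw0.not_ge,
      if_neg hw1.not_ge] at h'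
    split_ifs at h'
    exact Prod.mk.inj (Sum.inr_injective h')
  · rintro ⟨rfl, rfl⟩
    rfl

end Points

section Hinges

lemma hasDerivWithinAt_hinge_right (τ u : ℝ) :
    HasDerivWithinAt (fun w => max 0 (w - τ)) (if τ ≤ u then 1 else 0) (Set.Ici u) u := by
  split_ifs with h
  · refine (((hasDerivAt_id u).sub_const τ).hasDerivWithinAt).congr (fun w hw => ?_) ?_
    · exact max_eq_right (sub_nonneg.2 (h.trans hw))
    · exact max_eq_right (sub_nonneg.2 h)
  · refine HasDerivAt.hasDerivWithinAt ((hasDerivAt_const u (0 : ℝ)).congr_of_eventuallyEq ?_)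
    filter_upwards [gt_mem_nhds (not_le.1 h)] with w hw
    exact max_eq_left (by linarith)

lemma hasDerivWithinAt_hinge_left (τ u : ℝ) :
    HasDerivWithinAt (fun w => max 0 (w - τ)) (if τ < u then 1 else 0) (Set.Iic u) u := by
  split_ifs with h
  · refine HasDerivAt.hasDerivWithinAt (((hasDerivAt_id u).sub_const τ).congr_of_eventuallyEq ?_)
    filter_upwards [lt_mem_nhds h] with w hw
    exact max_eq_right (sub_nonneg.2 hw.le)
  · refine (hasDerivWithinAt_const u _ (0 : ℝ)).congr (fun w hw => ?_) ?_
    · have : w ≤ u := hw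
      exact max_eq_left (by linarith)
    · exact max_eq_left (by linarith)

variable {G : CombGraph} {J : Type} [Fintype J]

/-- The function with initial value `b`, initial slope `s` and slope changes `c j` at `t j`. -/
def hinge (b s : ℝ) (c : J → ℤ) (t : J → ℝ) (u : ℝ) : ℝ :=
  b + s * u + ∑ j, c j * max 0 (u - t j)

lemma continuous_hinge (b s : ℝ) (c : J → ℤ) (t : J → ℝ) : Continuous (hinge b s c t) := by
  unfold hinge
  fun_prop

lemma hasDerivWithinAt_hinge {b s : ℝ} {c : J → ℤ} {t : J → ℝ} {u : ℝ} {S : Set ℝ} {d : J → ℝ}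
    (h : ∀ j, HasDerivWithinAt (fun w => max 0 (w - t j)) (d j) S u) :
    HasDerivWithinAt (hinge b s c t) (s + ∑ j, c j * d j) S u := by
  have h1 : HasDerivWithinAt (fun w : ℝ => b + s * w) s S u := by
    simpa using (((hasDerivAt_id u).const_mul s).const_add b).hasDerivWithinAt
  exact h1.add (HasDerivWithinAt.fun_sum fun j _ => (h j).const_mul _)

lemma pwIntAffine_hinge {L : ℝ} (hL : 0 < L) (b : ℝ) (s : ℤ) (c : J → ℤ) {t : J → ℝ}
    {g : ℝ → ℝ} (hg : ∀ u, 0 ≤ u → u ≤ L → g u = hinge b s c t u) : PWIntAffine g L := by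
  set T : Finset ℝ := insert 0 (insert L ((Finset.univ.image t).filter fun τ => 0 ≤ τ ∧ τ ≤ L))
    with hT
  have h0T : (0 : ℝ) ∈ T := by simp [hT]
  have hLT : L ∈ T := by simp [hT]
  have hTb : ∀ τ ∈ T, 0 ≤ τ ∧ τ ≤ L := by
    intro τ hτ
    simp only [hT, Finset.mem_insert, Finset.mem_filter] at hτ
    rcases hτ with rfl | rfl | hτ
    · exact ⟨le_rfl, hL.le⟩
    · exact ⟨hL.le, le_rfl⟩
    · exact hτ.2
  obtain ⟨n, hn⟩ : ∃ n, T.card = n + 1 :=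
    Nat.exists_eq_succ_of_ne_zero (Finset.card_pos.2 ⟨0, h0T⟩).ne'
  set q := T.orderEmbOfFin hn with hq
  have hqT : ∀ i, q i ∈ T := fun i => T.orderEmbOfFin_mem hn i
  have hsurj : ∀ τ ∈ T, ∃ i, q i = τ := fun τ hτ => by
    have := T.range_orderEmbOfFin hn
    have h : τ ∈ Set.range (T.orderEmbOfFin hn) := by rw [this]; exact hτ
    exact h
  set p : ℕ → ℝ := fun i => q (Fin.ofNat (n + 1) i) with hp
  have hofNat : ∀ i (hi : i < n + 1), Fin.ofNat (n + 1) i = ⟨i, hi⟩ := fun i hi =>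
    Fin.ext (Nat.mod_eq_of_lt hi)
  have hpi : ∀ i (hi : i < n + 1), p i = q ⟨i, hi⟩ := fun i hi => by rw [hp, ← hofNat i hi]
  refine ⟨n, p, fun i => s + ∑ j, if t j ≤ p i then c j else 0,
    fun i => b - ∑ j, if t j ≤ p i then c j * t j else 0, ?_, ?_, ?_, ?_⟩
  · obtain ⟨i, hi⟩ := hsurj 0 h0T
    refine le_antisymm ?_ (hTb _ (hqT _)).1
    rw [← hi, hpi 0 (by omega)]
    exact q.monotone (Fin.zero_le i)
  · obtain ⟨i, hi⟩ := hsurj L hLT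
    refine le_antisymm (hTb _ (hqT _)).2 ?_
    rw [← hi, hpi n (by omega)]
    exact q.monotone (Fin.le_last i)
  · intro i hi
    rw [hpi i (by omega), hpi (i + 1) (by omega)]
    exact q.strictMono (by simp [Fin.lt_def])
  · intro i hi u hu0 hu1
    have hu0' : 0 ≤ u := (hTb _ (hqT _)).1.trans hu0
    have hu1' : u ≤ L := hu1.trans (hTb _ (hqT _)).2
    rw [hg u hu0' hu1', hinge]
    have key : ∀ j, (c j : ℝ) * max 0 (u - t j) =
        (if t j ≤ p i then (c j : ℝ) else 0) * u - if t j ≤ p i then c j * t j else 0 := by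
      intro j
      split_ifs with h
      · rw [max_eq_right (by linarith)]; ring
      · have h2 : p (i + 1) ≤ t j := by
          by_contra! hlt
          have hb : 0 ≤ t j ∧ t j ≤ L :=
            ⟨(hTb _ (hqT _)).1.trans (not_le.1 h).le, hlt.le.trans (hTb _ (hqT _)).2⟩
          obtain ⟨k, hk⟩ := hsurj (t j) (by simp [hT, hb])
          rw [hpi (i + 1) (by omega), ← hk] at hlt
          rw [hpi i (by omega), ← hk, not_le] at h
          have h3 := q.lt_iff_lt.1 h
          have h4 := q.lt_iff_lt.1 hlt
          rw [Fin.lt_def] at h3 h4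
          dsimp only at h3 h4
          omega
        rw [max_eq_left (by linarith)]; ring
    rw [Finset.sum_congr rfl fun j _ => key j, Finset.sum_sub_distrib, ← Finset.sum_mul]
    push_cast
    ring

lemma exists_mem_piece {t : ℕ → ℝ} {n : ℕ} {u : ℝ} (h0 : t 0 ≤ u) (hn : u ≤ t n) (hn0 : 0 < n) :
    ∃ k < n, t k ≤ u ∧ u ≤ t (k + 1) := by
  induction n with
  | zero => omega
  | succ n ih =>
    rcases le_total (t n) u with h | h
    · exact ⟨n, by omega, h, hn⟩
    · rcases Nat.eq_zero_or_pos n with rfl | hpos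
      · exact ⟨0, by omega, h0, hn⟩
      · obtain ⟨k, hk, h⟩ := ih h hpos
        exact ⟨k, by omega, h⟩

lemma exists_hinge {g : ℝ → ℝ} {L : ℝ} (hL : 0 < L) (hg : PWIntAffine g L) :
    ∃ (n : ℕ) (c : Fin n → ℤ) (t : Fin n → ℝ) (b : ℝ) (s : ℤ), (∀ j, 0 ≤ t j ∧ t j ≤ L) ∧
      ∀ u, 0 ≤ u → u ≤ L → g u = hinge b s c t u := by
  obtain ⟨n, t, m, b, ht0, htn, ht, hg⟩ := hg
  have hn : 0 < n := by
    rcases Nat.eq_zero_or_pos n with rfl | h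
    · linarith
    · exact h
  have hmono : ∀ i k, i ≤ k → k ≤ n → t i ≤ t k := by
    intro i k hik
    induction k, hik using Nat.le_induction with
    | base => intro _; exact le_rfl
    | succ k _ ih => intro hk; exact (ih (by omega)).trans (ht k (by omega)).le
  have hpiece : ∀ k < n, ∀ u, (m k : ℝ) * u + b k = b 0 + m 0 * u +
      ∑ i ∈ Finset.range k, ((m (i + 1) - m i : ℤ) : ℝ) * (u - t (i + 1)) := by
    intro k
    induction k with
    | zero => intro _ u; simp; ring
    | succ k ih =>
      intro hk u
      rw [Finset.sum_range_succ, ← add_assoc, ← ih (by omega)]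
      have h1 := hg k (by omega) (t (k + 1)) (ht k (by omega)).le le_rfl
      have h2 := hg (k + 1) hk (t (k + 1)) le_rfl (ht (k + 1) hk).le
      push_cast
      linarith
  refine ⟨n - 1, fun j => m (j + 1) - m j, fun j => t (j + 1), b 0, m 0, fun j => ?_,
    fun u hu0 hu1 => ?_⟩
  · have := j.2
    exact ⟨ht0 ▸ hmono 0 _ (by omega) (by omega), htn ▸ hmono _ n (by omega) le_rfl⟩
  · obtain ⟨k, hk, h1, h2⟩ := exists_mem_piece (ht0.le.trans hu0) (hu1.trans htn.ge) hn
    rw [hg k hk u h1 h2, hpiece k hk u, hinge]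
    congr 1
    refine Eq.trans ?_ (Fin.sum_univ_eq_sum_range
      (fun i => ((m (i + 1) - m i : ℤ) : ℝ) * max 0 (u - t (i + 1))) (n - 1)).symm
    refine Eq.trans (Finset.sum_congr rfl fun i hi => ?_) (Finset.sum_subset
      (s₁ := Finset.range k) (Finset.range_subset_range.2 (by omega)) fun i hi hik => ?_)
    · rw [Finset.mem_range] at hi
      rw [max_eq_right (sub_nonneg.2 ((hmono _ _ (by omega) (by omega)).trans h1))]
    · rw [Finset.mem_range] at hi hik
      rw [max_eq_left (sub_nonpos.2 (h2.trans (hmono _ _ (by omega) (by omega)))), mul_zero]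

end Hinges

end CombGraph

/-! ## Divisors of rational functions in hinge form -/

namespace CombGraph

open Filter Topology

variable {G : CombGraph} {J : Type} [Fintype J]

/-- On every edge `a`, the function `f` has initial slope `s a` and slope changes `c j` at the
points `t j` of the edge `e j`. -/
def HingeForm (f : RatFn G) (c : J → ℤ) (e : J → G.E) (t : J → ℝ) (b : G.E → ℝ)
    (s : G.E → ℤ) : Prop :=
  ∀ a u, 0 ≤ u → u ≤ G.len a →
    f.toFun (G.edgePt a u) = hinge (b a) (s a) (fun j => if e j = a then c j else 0) t u

/-- The contribution to the order at the vertex `v` of the slopes of a function in hinge form. -/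
def netSlope (c : J → ℤ) (e : J → G.E) (s : G.E → ℤ) (v : G.V) : ℤ :=
  ∑ a, ((if G.src a = v then s a else 0) -
    (if G.tgt a = v then s a + ∑ j, (if e j = a then c j else 0) else 0))

lemma sum_netSlope (c : J → ℤ) (e : J → G.E) (s : G.E → ℤ) :
    ∑ v, netSlope c e s v = -∑ j, c j := by
  simp only [netSlope]
  rw [Finset.sum_comm]
  simp only [Finset.sum_sub_distrib, Finset.sum_ite_eq, Finset.mem_univ, if_true,
    Finset.sum_add_distrib]
  rw [Finset.sum_comm]
  simp

lemma ordAt_vertexPt (f : RatFn G) (v : G.V) :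
    G.ordAt f (G.vertexPt v) = ∑ a, ((if G.src a = v then G.rightSlope f a 0 else 0) +
      (if G.tgt a = v then -(G.leftSlope f a (G.len a)) else 0)) := by
  have h : ∃ w : G.V, G.vertexPt v = G.vertexPt w := ⟨v, rfl⟩
  have hv : h.choose = v := (vertexPt_injective h.choose_spec).symm
  rw [ordAt, dif_pos h, hv]

lemma ordAt_edgePt (f : RatFn G) {a : G.E} {u : ℝ} (h0 : 0 < u) (h1 : u < G.len a) :
    G.ordAt f (G.edgePt a u) = G.rightSlope f a u - G.leftSlope f a u := by
  have hn : ¬ ∃ v : G.V, G.edgePt a u = G.vertexPt v := by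
    rintro ⟨v, hv⟩
    rcases (edgePt_eq_vertexPt h0.le h1.le).1 hv with h | h <;> linarith [h.1]
  have h : ∃ p : G.E × ℝ, 0 < p.2 ∧ p.2 < G.len p.1 ∧ G.edgePt a u = G.edgePt p.1 p.2 :=
    ⟨(a, u), h0, h1, rfl⟩
  have hs := h.choose_spec
  have hp := (edgePt_eq_edgePt h0.le h1.le hs.1 hs.2.1).1 hs.2.2
  rw [ordAt, dif_neg hn, dif_pos h, ← hp.1, ← hp.2]

namespace HingeForm

variable {f : RatFn G} {c : J → ℤ} {e : J → G.E} {t : J → ℝ} {b : G.E → ℝ} {s : G.E → ℤ}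

lemma rightSlope_eq (h : HingeForm f c e t b s) {a : G.E} {u : ℝ} (h0 : 0 ≤ u)
    (h1 : u < G.len a) :
    G.rightSlope f a u = (s a + ∑ j, if e j = a ∧ t j ≤ u then c j else 0 : ℤ) := by
  have hd : HasDerivWithinAt (fun w => f.toFun (G.edgePt a w)) _ (Set.Ici u) u :=
    (hasDerivWithinAt_hinge (b := b a) (s := s a) (c := fun j => if e j = a then c j else 0)
      fun j => hasDerivWithinAt_hinge_right (t j) u).congr_of_eventuallyEq (by
        filter_upwards [self_mem_nhdsWithin, mem_nhdsWithin_of_mem_nhds (gt_mem_nhds h1)]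
          with w hw0 hw1
        exact h a w (h0.trans hw0) hw1.le) (h a u h0 h1.le)
  rw [rightSlope, hd.derivWithin (uniqueDiffWithinAt_Ici u)]
  push_cast
  congr 1
  refine Finset.sum_congr rfl fun j _ => ?_
  by_cases h2 : e j = a <;> by_cases h3 : t j ≤ u <;> simp [h2, h3]

lemma leftSlope_eq (h : HingeForm f c e t b s) {a : G.E} {u : ℝ} (h0 : 0 < u)
    (h1 : u ≤ G.len a) :
    G.leftSlope f a u = (s a + ∑ j, if e j = a ∧ t j < u then c j else 0 : ℤ) := by
  have hd : HasDerivWithinAt (fun w => f.toFun (G.edgePt a w)) _ (Set.Iic u) u :=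
    (hasDerivWithinAt_hinge (b := b a) (s := s a) (c := fun j => if e j = a then c j else 0)
      fun j => hasDerivWithinAt_hinge_left (t j) u).congr_of_eventuallyEq (by
        filter_upwards [self_mem_nhdsWithin, mem_nhdsWithin_of_mem_nhds (lt_mem_nhds h0)]
          with w hw1 hw0
        exact h a w hw0.le (le_trans hw1 h1)) (h a u h0.le h1)
  rw [leftSlope, hd.derivWithin (uniqueDiffWithinAt_Iic u)]
  push_cast
  congr 1
  refine Finset.sum_congr rfl fun j _ => ?_
  by_cases h2 : e j = a <;> by_cases h3 : t j < u <;> simp [h2, h3]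

lemma ordAt_eq (h : HingeForm f c e t b s) (ht0 : ∀ j, 0 ≤ t j) (ht1 : ∀ j, t j ≤ G.len (e j))
    (x : G.Space) :
    G.ordAt f x = (∑ j, c j * delta (G.edgePt (e j) (t j)) x +
      ∑ v, netSlope c e s v * delta (G.vertexPt v) x : ℤ) := by
  rcases eq_vertexPt_or_edgePt x with ⟨v, rfl⟩ | ⟨a, u, hu0, hu1, rfl⟩
  · have hv : ∑ w, netSlope c e s w * delta (G.vertexPt w) (G.vertexPt v) = netSlope c e s v := by
      simp [delta, vertexPt_injective.eq_iff]
    have hj : ∀ j, c j * delta (G.edgePt (e j) (t j)) (G.vertexPt v) =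
        ∑ a, ((if G.src a = v then (if e j = a ∧ t j ≤ 0 then c j else 0) else 0) +
          (if G.tgt a = v then (if e j = a then c j else 0) -
            (if e j = a ∧ t j < G.len a then c j else 0) else 0)) := by
      intro j
      rw [Finset.sum_eq_single (e j) (fun a _ ha => by simp [ha.symm]) (by simp), delta]
      have hl := G.len_pos (e j)
      by_cases h1 : t j ≤ 0
      · have h2 : t j < G.len (e j) := h1.trans_lt hl
        simp [edgePt_eq_vertexPt (ht0 j) (ht1 j), h1, h2, h2.not_ge]
      · by_cases h2 : t j < G.len (e j)
        · simp [edgePt_eq_vertexPt (ht0 j) (ht1 j), h1, h2, h2.not_ge]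
        · simp [edgePt_eq_vertexPt (ht0 j) (ht1 j), h1, h2, not_lt.1 h2]
    rw [ordAt_vertexPt, hv, Finset.sum_congr rfl fun j _ => hj j, Finset.sum_comm, netSlope,
      ← Finset.sum_add_distrib, Int.cast_sum]
    refine Finset.sum_congr rfl fun a _ => ?_
    rw [h.rightSlope_eq le_rfl (G.len_pos a), h.leftSlope_eq (G.len_pos a) le_rfl]
    by_cases h1 : G.src a = v <;> by_cases h2 : G.tgt a = v <;>
      simp only [h1, h2, if_true, if_false, Finset.sum_add_distrib, Finset.sum_sub_distrib,
        Finset.sum_const_zero] <;> push_cast <;> ring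
  · have hv : ∀ w, delta (G.vertexPt w) (G.edgePt a u) = 0 := fun w => delta_of_ne fun hw => by
      rcases (edgePt_eq_vertexPt hu0.le hu1.le).1 hw.symm with h | h <;> linarith [h.1]
    rw [ordAt_edgePt f hu0 hu1, h.rightSlope_eq hu0.le hu1, h.leftSlope_eq hu0 hu1.le,
      ← Int.cast_sub]
    simp only [hv, mul_zero, Finset.sum_const_zero, add_zero, add_sub_add_left_eq_sub,
      ← Finset.sum_sub_distrib]
    congr 1
    refine Finset.sum_congr rfl fun j _ => ?_
    simp only [delta, edgePt_eq_edgePt (ht0 j) (ht1 j) hu0 hu1]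
    by_cases h2 : e j = a
    · rcases lt_trichotomy (t j) u with h3 | h3 | h3
      · simp [h2, h3, h3.le, h3.ne]
      · simp [h2, h3]
      · simp [h2, h3.not_ge, h3.not_gt, h3.ne']
    · simp [h2]

lemma isPrincipal_iff (h : HingeForm f c e t b s) (ht0 : ∀ j, 0 ≤ t j)
    (ht1 : ∀ j, t j ≤ G.len (e j)) {D : Div G} :
    G.IsPrincipal D f ↔ D = ∑ j, c j • Finsupp.single (G.edgePt (e j) (t j)) 1 +
      ∑ v, netSlope c e s v • Finsupp.single (G.vertexPt v) 1 := by
  have key : ∀ x, (∑ j, c j • Finsupp.single (G.edgePt (e j) (t j)) (1 : ℤ) +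
      ∑ v, netSlope c e s v • Finsupp.single (G.vertexPt v) (1 : ℤ)) x =
      ∑ j, c j * delta (G.edgePt (e j) (t j)) x +
      ∑ v, netSlope c e s v * delta (G.vertexPt v) x := fun x => by
    simp [Finsupp.single_apply, delta]
  simp only [IsPrincipal, h.ordAt_eq ht0 ht1, Int.cast_inj, ← key]
  exact Finsupp.ext_iff.symm

end HingeForm

lemma exists_hingeForm (f : RatFn G) :
    ∃ (J : Type) (_ : Fintype J) (c : J → ℤ) (e : J → G.E) (t : J → ℝ) (b : G.E → ℝ)
      (s : G.E → ℤ), (∀ j, 0 ≤ t j ∧ t j ≤ G.len (e j)) ∧ HingeForm f c e t b s := by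
  choose n c t b s ht hf using fun a => exists_hinge (G.len_pos a) (f.piecewise a)
  refine ⟨Σ a, Fin (n a), inferInstance, fun j => c j.1 j.2, fun j => j.1, fun j => t j.1 j.2, b, s,
    fun j => ht j.1 j.2, fun a u h0 h1 => ?_⟩
  refine (hf a u h0 h1).trans ?_
  rw [hinge, hinge, Fintype.sum_sigma, Finset.sum_eq_single a]
  · simp
  · intro a' _ ha'
    simp [ha']
  · simp

/-- The degree of divisors as a group homomorphism. -/
def degHom (G : CombGraph) : Div G →+ ℤ := Finsupp.liftAddHom fun _ => AddMonoidHom.id ℤ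

lemma degHom_apply (D : Div G) : degHom G D = G.degDiv D := rfl

@[simp] lemma degHom_single (x : G.Space) (n : ℤ) : degHom G (Finsupp.single x n) = n := by
  simp [degHom]

lemma degHom_eq_zero {D : Div G} {f : RatFn G} (h : G.IsPrincipal D f) : degHom G D = 0 := by
  obtain ⟨J, _, c, e, t, b, s, ht, hf⟩ := exists_hingeForm f
  rw [(hf.isPrincipal_iff (fun j => (ht j).1) fun j => (ht j).2).1 h]
  simp only [map_add, map_sum, map_zsmul, degHom_single, smul_eq_mul, mul_one, sum_netSlope]
  ring

lemma EdgeRel.exists_isPrincipal {c : J → ℤ} {e : J → G.E} {t : J → ℝ} {s : G.E → ℤ}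
    (h : G.EdgeRel G.len c e t s) :
    ∃ f : RatFn G, G.IsPrincipal (∑ j, c j • Finsupp.single (G.edgePt (e j) (t j)) 1) f := by
  obtain ⟨φ, hφ⟩ := h.potential
  have h0 : ∀ a, hinge (φ (G.src a)) (s a) (fun j => if e j = a then c j else 0) t 0 =
      φ (G.src a) := fun a => by
    have : ∀ j, max 0 (0 - t j) = 0 := fun j => max_eq_left (by linarith [h.nonneg j])
    simp only [hinge, this, mul_zero, Finset.sum_const_zero, add_zero]
  have h1 : ∀ a, hinge (φ (G.src a)) (s a) (fun j => if e j = a then c j else 0) t (G.len a) =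
      φ (G.tgt a) := fun a => by
    rw [hinge, ← sub_add_cancel (φ (G.tgt a)) (φ (G.src a)), hφ, add_assoc, add_comm]
    congr 2
    refine Finset.sum_congr rfl fun j _ => ?_
    split_ifs with hj
    · have := h.le_len j
      rw [hj] at this
      rw [max_eq_right (sub_nonneg.2 this)]
    · simp
  have hg : ∀ a u, 0 ≤ u → u ≤ G.len a → glueMap φ _ h0 h1 (G.edgePt a u) = _ :=
    fun a u hu0 hu1 => glueMap_edgePt hu0 hu1
  let f : RatFn G := ⟨glueMap φ _ h0 h1, continuous_glueMap fun a => continuous_hinge _ _ _ _,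
    fun a => pwIntAffine_hinge (G.len_pos a) _ _ _ (hg a)⟩
  have hf : HingeForm f c e t (fun a => φ (G.src a)) s := hg
  refine ⟨f, (hf.isPrincipal_iff h.nonneg h.le_len).2 ?_⟩
  have hn : ∀ v, netSlope c e s v = 0 := h.vertex
  simp [hn]

end CombGraph

/-! ## Limits of configurations on finer and finer subdivisions -/

namespace CombGraph

open Filter Topology

variable {G : CombGraph}

/-- The number of inner vertices on the edge `a` of a subdivision with mesh about `1 / (n + 1)`. -/
def mesh (G : CombGraph) (n : ℕ) (a : G.E) : ℕ := ⌊((n : ℝ) + 1) * G.len a⌋₊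

lemma tendsto_mul_floor (u : ℝ) (hu : 0 ≤ u) :
    Tendsto (fun n : ℕ => 1 / ((n : ℝ) + 1) * (⌊((n : ℝ) + 1) * u⌋₊ : ℝ)) atTop (𝓝 u) := by
  have h := (tendsto_nat_floor_mul_div_atTop hu).comp
    (tendsto_atTop_add_const_right _ (1 : ℝ) tendsto_natCast_atTop_atTop)
  refine h.congr fun n => ?_
  simp only [Function.comp_apply]
  rw [mul_comm u]
  ring

lemma tendsto_scale_mul_const (r : ℝ) :
    Tendsto (fun n : ℕ => 1 / ((n : ℝ) + 1) * r) atTop (𝓝 0) := by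
  simpa using tendsto_one_div_add_atTop_nhds_zero_nat.mul_const r

lemma tendsto_mesh (a : G.E) :
    Tendsto (fun n : ℕ => 1 / ((n : ℝ) + 1) * ((G.mesh n a : ℝ) + 1)) atTop (𝓝 (G.len a)) := by
  have h := (tendsto_mul_floor (G.len a) (G.len_pos a).le).add (tendsto_scale_mul_const 1)
  rw [add_zero] at h
  exact h.congr fun n => (mul_add _ _ _).symm

lemma eventually_le_mesh (G : CombGraph) (R : ℕ) : ∀ᶠ n in atTop, ∀ a, R ≤ G.mesh n a := by
  refine eventually_all.2 fun a => ?_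
  have h : Tendsto (fun n : ℕ => ((n : ℝ) + 1) * G.len a) atTop atTop :=
    (tendsto_atTop_add_const_right _ (1 : ℝ) tendsto_natCast_atTop_atTop).atTop_mul_const
      (G.len_pos a)
  exact (tendsto_nat_floor_atTop.comp h).eventually_ge_atTop R

/-- The positions `p n` on the subdivisions of mesh `1 / (n + 1)` converge along `U` to the point
with coordinate `u` on the edge `a`. -/
structure Converges (G : CombGraph) (U : Ultrafilter ℕ) (p : ℕ → G.E × ℕ) (a : G.E) (u : ℝ) :
    Prop where
  edge : ∀ᶠ n in (U : Filter ℕ), (p n).1 = a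
  coord : Tendsto (fun n : ℕ => 1 / ((n : ℝ) + 1) * ((p n).2 : ℝ)) U (𝓝 u)
  valid : ∀ᶠ n in (U : Filter ℕ), (p n).2 ≤ G.mesh n (p n).1 + 1

namespace Converges

variable {U : Ultrafilter ℕ} {p q : ℕ → G.E × ℕ} {a b : G.E} {u w : ℝ} {R : ℕ}

lemma nonneg (h : G.Converges U p a u) : 0 ≤ u :=
  ge_of_tendsto' h.coord fun _ => by positivity

lemma le_len (h : G.Converges U p a u) (hU : (U : Filter ℕ) ≤ atTop) : u ≤ G.len a := by
  refine le_of_tendsto_of_tendsto h.coord ((tendsto_mesh a).mono_left hU) ?_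
  filter_upwards [h.edge, h.valid] with n h1 h2
  rw [h1] at h2
  exact mul_le_mul_of_nonneg_left (by exact_mod_cast h2) (by positivity)

lemma le_of_le_add {x y : ℕ → ℕ} {u w : ℝ} (hU : (U : Filter ℕ) ≤ atTop)
    (hx : Tendsto (fun n : ℕ => 1 / ((n : ℝ) + 1) * (x n : ℝ)) U (𝓝 u))
    (hy : Tendsto (fun n : ℕ => 1 / ((n : ℝ) + 1) * (y n : ℝ)) U (𝓝 w))
    (h : ∀ᶠ n in (U : Filter ℕ), x n ≤ y n + R) : u ≤ w := by
  have hy' := hy.add ((tendsto_scale_mul_const R).mono_left hU)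
  rw [add_zero] at hy'
  refine le_of_tendsto_of_tendsto hx hy' ?_
  filter_upwards [h] with n hn
  rw [← mul_add]
  exact mul_le_mul_of_nonneg_left (by exact_mod_cast hn) (by positivity)

lemma eq_vertexPt (h : G.Converges U p a u) (hU : (U : Filter ℕ) ≤ atTop) {v : G.V}
    (hv : ∀ᶠ n in (U : Filter ℕ), EndClose (G.mesh n) R v (p n)) :
    G.edgePt a u = G.vertexPt v := by
  rw [edgePt_eq_vertexPt h.nonneg (h.le_len hU)]
  refine (Ultrafilter.eventually_or.1 hv).imp (fun hv => ⟨?_, ?_⟩) fun hv => ⟨?_, ?_⟩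
  · refine le_of_le_add (y := fun _ => 0) (R := R) hU h.coord (by simp) ?_
    filter_upwards [hv] with n hn
    simpa using hn.2
  · obtain ⟨n, h1, h2⟩ := (h.edge.and hv).exists
    rw [← h1, h2.1]
  · refine le_of_le_add (x := fun n => G.mesh n a + 1) (R := R) hU ?_ h.coord ?_
    · simpa using (tendsto_mesh a).mono_left hU
    · filter_upwards [h.edge, hv] with n h1 h2
      rw [← h1]
      exact h2.2
  · obtain ⟨n, h1, h2⟩ := (h.edge.and hv).exists
    rw [← h1, h2.1]

lemma edgePt_eq_of_close (hp : G.Converges U p a u) (hq : G.Converges U q b w)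
    (hU : (U : Filter ℕ) ≤ atTop)
    (h : ∀ᶠ n in (U : Filter ℕ), Close (G.mesh n) R (p n) (q n)) :
    G.edgePt a u = G.edgePt b w := by
  rcases Ultrafilter.eventually_or.1 h with h | h
  · obtain ⟨n, h1, h2, h3⟩ := (hp.edge.and (hq.edge.and h)).exists
    have hab : a = b := by rw [← h1, ← h2, h3.1]
    have huw : u = w := le_antisymm
      (le_of_le_add hU hp.coord hq.coord (h.mono fun n hn => hn.2.1))
      (le_of_le_add hU hq.coord hp.coord (h.mono fun n hn => hn.2.2))
    rw [hab, huw]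
  · have h' : ∀ n, ∃ v, (∃ v, EndClose (G.mesh n) R v (p n) ∧ EndClose (G.mesh n) R v (q n)) →
        EndClose (G.mesh n) R v (p n) ∧ EndClose (G.mesh n) R v (q n) := fun n => by
      by_cases hn : ∃ v, EndClose (G.mesh n) R v (p n) ∧ EndClose (G.mesh n) R v (q n)
      · exact hn.imp fun v hv _ => hv
      · exact ⟨G.src a, fun h => absurd h hn⟩
    choose v hv using h'
    obtain ⟨v₀, -, hv₀⟩ := exists_eventually_eq U Set.finite_univ v (by simp)
    have hpq := h.and hv₀
    rw [hp.eq_vertexPt hU (R := R) (v := v₀) (hpq.mono fun n hn => hn.2 ▸ (hv n hn.1).1),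
      hq.eq_vertexPt hU (R := R) (v := v₀) (hpq.mono fun n hn => hn.2 ▸ (hv n hn.1).2)]

lemma edge_unique (h : G.Converges U p a u) (h' : G.Converges U p b w) : a = b := by
  obtain ⟨n, h1, h2⟩ := (h.edge.and h'.edge).exists
  exact h1.symm.trans h2

lemma edgePt_unique (h : G.Converges U p a u) (h' : G.Converges U p b w) :
    G.edgePt a u = G.edgePt b w := by
  obtain rfl := h.edge_unique h'
  rw [tendsto_nhds_unique h.coord h'.coord]

end Converges

lemma exists_converges {U : Ultrafilter ℕ} (hU : (U : Filter ℕ) ≤ atTop) {p : ℕ → G.E × ℕ}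
    (hp : ∀ᶠ n in (U : Filter ℕ), (p n).2 ≤ G.mesh n (p n).1 + 1) :
    ∃ a u, G.Converges U p a u := by
  obtain ⟨a, -, ha⟩ := exists_eventually_eq U Set.finite_univ (fun n => (p n).1) (by simp)
  obtain ⟨u, hu⟩ := exists_tendsto_of_mem_Icc U
      (u := fun n : ℕ => 1 / ((n : ℝ) + 1) * ((p n).2 : ℝ)) (a := 0) (b := G.len a + 1) (by
    filter_upwards [hp, ha, ((tendsto_mesh a).eventually_le_const
      (lt_add_one (G.len a))).filter_mono hU] with n h1 h2 h3
    rw [h2] at h1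
    refine ⟨by positivity, le_trans (mul_le_mul_of_nonneg_left ?_ (by positivity)) h3⟩
    exact_mod_cast h1)
  exact ⟨a, u, ha, hu, hp⟩

lemma converges_floor {U : Ultrafilter ℕ} (hU : (U : Filter ℕ) ≤ atTop) {a : G.E} {u : ℝ}
    (h0 : 0 ≤ u) (h1 : u ≤ G.len a) :
    G.Converges U (fun n : ℕ => (a, ⌊((n : ℝ) + 1) * u⌋₊)) a u where
  edge := by simp
  coord := (tendsto_mul_floor u h0).mono_left hU
  valid := Eventually.of_forall fun n => (Nat.floor_le_floor
    (mul_le_mul_of_nonneg_left h1 (by positivity))).trans (Nat.le_succ _)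

/-- There is a point `x` such that removing any point from the `γ + 1`-fold multiple of `x`
leaves a divisor equivalent to an effective one. -/
theorem exists_moved_point (hG : G.Linked) (hinc : ∀ v, ∃ e, G.src e = v ∨ G.tgt e = v) {γ : ℕ}
    (hγ : (Fintype.card G.E : ℤ) - Fintype.card G.V = γ) (hγ1 : 1 ≤ γ) :
    ∃ x : G.Space, ∀ (a : G.E) (u : ℝ), 0 ≤ u → u ≤ G.len a →
      ∃ (b : Fin γ → G.Space) (f : RatFn G), G.IsPrincipal (((γ : ℤ) + 1) • Finsupp.single x 1 -
        Finsupp.single (G.edgePt a u) 1 - ∑ k, Finsupp.single (b k) 1) f := by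
  obtain ⟨R, hR⟩ := exists_close_chips hG hinc hγ hγ1
  set U := hyperfilter ℕ
  have hU : (U : Filter ℕ) ≤ atTop := Nat.hyperfilter_le_atTop
  have hR' : ∀ n, ∃ p : Fin (γ + 1) → G.E × ℕ, (∀ e, R ≤ G.mesh n e) →
      (∀ j, (p j).2 ≤ G.mesh n (p j).1 + 1) ∧ (∀ j k, Close (G.mesh n) R (p j) (p k)) ∧
      ∃ f, ∀ x, 0 ≤ (G.subdiv (G.mesh n)).can x - chips (G.mesh n) (fun _ => 1) p x +
        (G.subdiv (G.mesh n)).lap f x := fun n => by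
    by_cases hn : ∀ e, R ≤ G.mesh n e
    · exact (hR _ hn).imp fun p hp _ => hp
    · have he : Nonempty G.E := (not_forall.1 hn).nonempty
      exact ⟨fun _ => (he.some, 0), fun h => absurd h hn⟩
  choose p hp using hR'
  have hpU := ((eventually_le_mesh G R).filter_mono hU).mono hp
  obtain ⟨a₀, u₀, h₀⟩ := exists_converges (p := fun n => p n 0) hU (hpU.mono fun n hn => hn.1 0)
  refine ⟨G.edgePt a₀ u₀, fun a u hu0 hu1 => ?_⟩
  have hy := converges_floor (U := U) hU hu0 hu1
  set y : ℕ → G.E × ℕ := fun n : ℕ => (a, ⌊((n : ℝ) + 1) * u⌋₊)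
  set c : Fin (γ + 1) ⊕ Option (Fin γ) → ℤ := Sum.elim (fun _ => 1) (fun _ => -1)
  have hq : ∀ n, ∃ q : Fin γ → G.E × ℕ, (∀ e, max R 1 ≤ G.mesh n e) →
      ∃ s : G.E → ℤ, (∀ a, |s a| ≤ (γ + 2) + ∑ j, |c j|) ∧
        G.EdgeRel (fun a => 1 / ((n : ℝ) + 1) * ((G.mesh n a : ℝ) + 1)) c
          (fun j => (Sum.elim (p n) (fun o : Option (Fin γ) => o.elim (y n) q) j).1)
          (fun j => 1 / ((n : ℝ) + 1) *
            ((Sum.elim (p n) (fun o : Option (Fin γ) => o.elim (y n) q) j).2 : ℝ)) s := by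
    intro n
    by_cases hn : ∀ e, max R 1 ≤ G.mesh n e
    · obtain ⟨hp1, -, hp2⟩ := hp n fun e => (le_max_left R 1).trans (hn e)
      obtain ⟨q, f, hq, hB, hf⟩ := exists_moved_chips hG hinc hγ
        (fun e => (le_max_right R 1).trans (hn e)) hp2 (y n)
      obtain ⟨s, hs, hrel⟩ := exists_edgeRel_of_lap (p := Sum.elim (p n)
        (fun o : Option (Fin γ) => o.elim (y n) q)) (by
          rintro (j | _ | j)
          · exact hp1 j
          · exact (Nat.floor_le_floor
              (mul_le_mul_of_nonneg_left hu1 (by positivity))).trans (Nat.le_succ _)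
          · exact hq j) hf hB
      exact ⟨q, fun _ => ⟨s, hs, hrel.smul (by positivity)⟩⟩
    · exact ⟨fun _ => (a, 0), fun h => absurd h hn⟩
  choose q hq using hq
  obtain ⟨e, t, s, hrel, he, ht⟩ := EdgeRel.exists_limit U
    (fun a => (tendsto_mesh a).mono_left hU)
    (((eventually_le_mesh G (max R 1)).filter_mono hU).mono hq)
  obtain ⟨f, hf⟩ := hrel.exists_isPrincipal
  refine ⟨fun k => G.edgePt (e (Sum.inr (some k))) (t (Sum.inr (some k))), f, ?_⟩
  have hx : ∀ j : Fin (γ + 1), G.edgePt (e (Sum.inl j)) (t (Sum.inl j)) = G.edgePt a₀ u₀ := by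
    intro j
    have hj : G.Converges U (fun n => p n j) (e (Sum.inl j)) (t (Sum.inl j)) :=
      ⟨he.mono fun n hn => congrFun hn (Sum.inl j), ht (Sum.inl j), hpU.mono fun n hn => hn.1 j⟩
    exact hj.edgePt_eq_of_close h₀ hU (hpU.mono fun n hn => hn.2.1 j 0)
  have hya : G.edgePt (e (Sum.inr none)) (t (Sum.inr none)) = G.edgePt a u := by
    have hj : G.Converges U y (e (Sum.inr none)) (t (Sum.inr none)) :=
      ⟨he.mono fun n hn => congrFun hn (Sum.inr none), ht (Sum.inr none), hy.valid⟩
    exact hj.edgePt_unique hy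
  convert hf using 1
  rw [Fintype.sum_sum_type, Fintype.sum_option]
  simp only [hx, hya, c, Sum.elim_inl, Sum.elim_inr, one_smul, neg_smul, Finset.sum_const,
    Finset.card_univ, Fintype.card_fin, Finset.sum_neg_distrib]
  rw [← natCast_zsmul]
  push_cast
  abel

/-! ## Connectedness and the rank -/

lemma linked_of_connectedSpace [ConnectedSpace G.Space] : G.Linked := by
  rintro A ⟨v, hv⟩ hA
  let F : G.Space → Bool := glueMap (fun w => decide (w ∈ A)) (fun a _ => decide (G.src a ∈ A))
    (fun _ => rfl) (fun a => by simp only [hA a])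
  have hF : Continuous F := continuous_glueMap fun a => continuous_const
  refine Set.eq_univ_of_forall fun w => ?_
  have h : decide (w ∈ A) = decide (v ∈ A) :=
    PreconnectedSpace.constant inferInstance hF (x := G.vertexPt w) (y := G.vertexPt v)
  simpa [hv] using h

lemma exists_incident (hG : G.Linked) (hE : Nonempty G.E) (v : G.V) :
    ∃ e, G.src e = v ∨ G.tgt e = v := by
  by_contra! h
  obtain ⟨e⟩ := hE
  have hv : G.src e ∈ ({v} : Set G.V) :=
    hG {v} ⟨v, rfl⟩ (fun e => by simp [(h e).1, (h e).2]) ▸ Set.mem_univ _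
  exact (h e).1 hv

lemma exists_edgePt (hinc : ∀ v, ∃ e, G.src e = v ∨ G.tgt e = v) (x : G.Space) :
    ∃ a u, 0 ≤ u ∧ u ≤ G.len a ∧ x = G.edgePt a u := by
  rcases eq_vertexPt_or_edgePt x with ⟨v, rfl⟩ | ⟨a, u, h0, h1, rfl⟩
  · obtain ⟨a, rfl | rfl⟩ := hinc v
    · exact ⟨a, 0, le_rfl, (G.len_pos a).le, (edgePt_zero a).symm⟩
    · exact ⟨a, G.len a, (G.len_pos a).le, le_rfl, (edgePt_len a).symm⟩
  · exact ⟨a, u, h0.le, h1.le, rfl⟩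

lemma degDiv_nonneg {D : Div G} (hD : G.Effective D) : 0 ≤ G.degDiv D :=
  Finset.sum_nonneg fun x _ => hD x

lemma exists_eq_single {D : Div G} (hD : G.Effective D) (h : G.degDiv D = 1) :
    ∃ y, D = Finsupp.single y 1 := by
  obtain ⟨y, hy⟩ : ∃ y, D y ≠ 0 := by
    by_contra! h0
    have : D = 0 := Finsupp.ext h0
    simp [this, degDiv] at h
  have hy1 : 1 ≤ D y := lt_of_le_of_ne (hD y) hy.symm
  have hE : G.Effective (D - Finsupp.single y 1) := fun x => by
    rw [Finsupp.sub_apply, Finsupp.single_apply]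
    split_ifs with hx
    · rw [← hx]; omega
    · simpa using hD x
  have hdeg : ∑ x ∈ (D - Finsupp.single y 1 : Div G).support,
      (D - Finsupp.single y 1 : Div G) x = 0 := by
    change G.degDiv _ = 0
    rw [← degHom_apply, map_sub, degHom_apply, h, degHom_single, sub_self]
  refine ⟨y, sub_eq_zero.1 (Finsupp.ext fun x => ?_)⟩
  by_contra hx
  exact hx ((Finset.sum_eq_zero_iff_of_nonneg fun x _ => hE x).1 hdeg x
    (Finsupp.mem_support_iff.2 hx))

lemma le_rk (x : G.Space) {D : Div G} {k : ℤ} (h : ∀ E : Div G, G.Effective E → G.degDiv E = k →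
    ∃ E' : Div G, G.Effective E' ∧ G.LinEquiv (D - E) E') : k ≤ G.Rk D := by
  refine le_csSup ⟨max 0 (G.degDiv D), fun n hn => ?_⟩ h
  by_contra! hlt
  have hn0 : 0 < n := (le_max_left _ _).trans_lt hlt
  obtain ⟨E', hE', f, hf⟩ := hn (Finsupp.single x n)
    (fun z => by rw [Finsupp.single_apply]; split_ifs <;> omega)
    (by rw [← degHom_apply, degHom_single])
  have hdeg := degHom_eq_zero hf
  rw [map_sub, map_sub, degHom_single, degHom_apply, degHom_apply] at hdeg
  have := degDiv_nonneg hE'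
  have := (le_max_right 0 (G.degDiv D)).trans_lt hlt
  omega

end CombGraph

/-- Statement 16: every metric graph of genus `g ≥ 2` has at least one
Weierstrass point. -/
theorem exists_weierstrass_point (G : CombGraph) (hcpt : CompactSpace G.Space)
    (hconn : ConnectedSpace G.Space) (hg : 2 ≤ G.genus) :
    ∃ x : G.Space, G.IsWeierstrass x := by
  have hG : G.Linked := CombGraph.linked_of_connectedSpace
  obtain ⟨γ, hγ⟩ : ∃ γ : ℕ, (Fintype.card G.E : ℤ) - Fintype.card G.V = γ :=
    Int.eq_ofNat_of_zero_le (by unfold CombGraph.genus at hg; omega)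
  have hgenus : G.genus = γ + 1 := by rw [CombGraph.genus, hγ]
  have hE : Nonempty G.E := Fintype.card_pos_iff.1 (by omega)
  have hinc := CombGraph.exists_incident hG hE
  obtain ⟨x, hx⟩ := CombGraph.exists_moved_point hG hinc hγ (by omega)
  refine ⟨x, CombGraph.le_rk x fun E hE0 hE1 => ?_⟩
  obtain ⟨y, rfl⟩ := CombGraph.exists_eq_single hE0 hE1
  obtain ⟨a, u, h0, h1, rfl⟩ := CombGraph.exists_edgePt hinc y
  obtain ⟨b, f, hf⟩ := hx a u h0 h1
  refine ⟨∑ k, Finsupp.single (b k) 1, fun z => ?_, f, hgenus ▸ hf⟩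
  rw [Finsupp.finsetSum_apply]
  refine Finset.sum_nonneg fun k _ => ?_
  rw [Finsupp.single_apply]
  split_ifs <;> simp
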